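/- Under the standing assumptions (D prime ≡ 1 mod 4, ~D squarefree ≡ 1 mod 4, N(D_{~K/~F}) = D, d_u(n) fundamental), let p | N and let p̂ be the unique prime of O_{~F} above p dividing (n+δ√~D)/(2D)·D_{~K/~F}. Then p̂ splits in ~K if and only if p splits in at least one of the quadratic orders O_{d_x} or O_{d_u}; and p̂ is inert in ~K if and only if p is inert in at least one of O_{d_x} or O_{d_u}. -/

import Mathlib

open NumberField IsDedekindDomain
open scoped nonZeroDivisors

/-- `d` is a fundamental discriminant: the discriminant of a quadratic field. -/
def IsFundamentalDiscriminant (d : ℤ) : Prop :=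
  (d % 4 = 1 ∧ Squarefree d) ∨
    (∃ m : ℤ, d = 4 * m ∧ Squarefree m ∧ (m % 4 = 2 ∨ m % 4 = 3))

/-- The rational prime `p` splits in the quadratic order of discriminant `d`
(Kronecker symbol `(d/p) = +1`). -/
def SplitsInOrder (d : ℤ) (p : ℕ) (hp : p.Prime) : Prop :=
  if p = 2 then d % 8 = 1 else
    letI : Fact p.Prime := ⟨hp⟩
    legendreSym p d = 1

/-- The rational prime `p` is inert in the quadratic order of discriminant `d`
(Kronecker symbol `(d/p) = -1`). -/
def InertInOrder (d : ℤ) (p : ℕ) (hp : p.Prime) : Prop :=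
  if p = 2 then d % 8 = 5 else
    letI : Fact p.Prime := ⟨hp⟩
    legendreSym p d = -1


theorem quad_rep {F K : Type*} [Field F] [Field K] [Algebra F K]
    (h2 : Module.finrank F K = 2) (t : K) (ht : ∀ c : F, algebraMap F K c ≠ t) (x : K) :
    ∃ a b : F, x = algebraMap F K a + algebraMap F K b * t := by
  have hli : LinearIndependent F ![(1 : K), t] := by
    rw [LinearIndependent.pair_iff]
    intro u v huv
    have hv : v = 0 := by
      by_contra hv
      apply ht (-u / v)
      have hv' : algebraMap F K v ≠ 0 := by simpa using hv
      rw [map_div₀, map_neg, div_eq_iff hv']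
      simp only [Algebra.smul_def] at huv
      linear_combination -huv
    subst hv
    simpa using huv
  have : FiniteDimensional F K := Module.finite_of_finrank_pos (by omega)
  have hspan := hli.span_eq_top_of_card_eq_finrank (by simp [h2])
  have hx : x ∈ Submodule.span F (Set.range ![(1 : K), t]) := by rw [hspan]; trivial
  rw [Matrix.range_cons, Matrix.range_cons, Matrix.range_empty, Set.union_empty,
    Set.singleton_union, Submodule.mem_span_pair] at hx
  obtain ⟨a, b, h⟩ := hx
  exact ⟨a, b, by rw [← h]; simp [Algebra.smul_def]⟩

theorem quad_uniq {F K : Type*} [Field F] [Field K] [Algebra F K]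
    (t : K) (ht : ∀ c : F, algebraMap F K c ≠ t) (a b a' b' : F)
    (h : algebraMap F K a + algebraMap F K b * t = algebraMap F K a' + algebraMap F K b' * t) :
    a = a' ∧ b = b' := by
  have hv : b - b' = 0 := by
    by_contra hv
    apply ht ((a' - a) / (b - b'))
    have hv' : algebraMap F K (b - b') ≠ 0 := (map_ne_zero _).mpr hv
    rw [map_div₀, div_eq_iff hv', map_sub, map_sub]
    linear_combination -h
  have hb : b = b' := sub_eq_zero.mp hv
  subst hb
  refine ⟨?_, rfl⟩
  exact (algebraMap F K).injective (by linear_combination h)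

theorem quad_trace {F K : Type*} [Field F] [Field K] [Algebra F K]
    (h2 : Module.finrank F K = 2) (t : K) (ht : ∀ c : F, algebraMap F K c ≠ t) (a b : F)
    (hq : t ^ 2 - algebraMap F K a * t + algebraMap F K b = 0) :
    Algebra.trace F K t = a := by
  have : FiniteDimensional F K := Module.finite_of_finrank_pos (by omega)
  have hdeg : (Polynomial.X ^ 2 + (-(Polynomial.C a * Polynomial.X) + Polynomial.C b) :
      Polynomial F).natDegree = 2 := by compute_degree!
  have hmon : (Polynomial.X ^ 2 + (-(Polynomial.C a * Polynomial.X) + Polynomial.C b) :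
      Polynomial F).Monic := by monicity!
  have hint : IsIntegral F t := Algebra.IsIntegral.isIntegral t
  have h2le : 2 ≤ (minpoly F t).natDegree := by
    rw [minpoly.two_le_natDegree_iff hint]
    rintro ⟨c, hc⟩
    exact ht c hc
  have hmp : minpoly F t = Polynomial.X ^ 2 + (-(Polynomial.C a * Polynomial.X) + Polynomial.C b) := by
    symm
    apply Polynomial.eq_of_monic_of_dvd_of_natDegree_le (minpoly.monic hint) hmon
    · apply minpoly.dvd
      simp
      linear_combination hq
    · rw [hdeg]; exact h2le
  rw [trace_eq_finrank_mul_minpoly_nextCoeff, hmp]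
  have h3 := Module.finrank_mul_finrank F (IntermediateField.adjoin F {t}) K
  rw [IntermediateField.adjoin.finrank hint, hmp, hdeg, h2] at h3
  have h4 : Module.finrank (IntermediateField.adjoin F {t}) K = 1 := by omega
  rw [h4, Polynomial.nextCoeff_of_natDegree_pos (by omega), hdeg]
  simp [Polynomial.coeff_C]


theorem integral_of_quad {R K : Type*} [CommRing R] [Nontrivial R] [CommRing K] [Algebra R K] (x : K) (a b : R)
    (h : x ^ 2 - algebraMap R K a * x + algebraMap R K b = 0) : IsIntegral R x := by
  refine ⟨Polynomial.X ^ 2 + (-(Polynomial.C a * Polynomial.X) + Polynomial.C b), by monicity!, ?_⟩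
  simp only [Polynomial.eval₂_add, Polynomial.eval₂_pow, Polynomial.eval₂_X, Polynomial.eval₂_neg,
      Polynomial.eval₂_mul, Polynomial.eval₂_C]
  linear_combination h

section QuadSplit
variable {F K : Type*} [Field F] [NumberField F] [Field K] [NumberField K] [Algebra F K]

theorem disc_rep (h2 : Module.finrank F K = 2) (t : 𝓞 K)
    (ht : ∀ c : F, algebraMap F K c ≠ (t : K)) (a b : 𝓞 F)
    (hq : t ^ 2 - algebraMap (𝓞 F) (𝓞 K) a * t + algebraMap (𝓞 F) (𝓞 K) b = 0) (y : 𝓞 K) :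
    ∃ u v : 𝓞 F, algebraMap (𝓞 F) (𝓞 K) (a ^ 2 - 4 * b) * y =
      algebraMap (𝓞 F) (𝓞 K) u + algebraMap (𝓞 F) (𝓞 K) v * t := by
  have hqK : (t : K) ^ 2 - algebraMap F K (a : F) * t + algebraMap F K (b : F) = 0 := by
    have := congrArg (algebraMap (𝓞 K) K) hq
    simpa [← IsScalarTower.algebraMap_apply] using this
  have htr := quad_trace h2 (t : K) ht _ _ hqK
  obtain ⟨u0, v0, hy⟩ := quad_rep h2 (t : K) ht (y : K)
  have : FiniteDimensional F K := Module.finite_of_finrank_pos (by omega)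
  have tr1 : Algebra.trace F K (y : K) = 2 * u0 + v0 * a := by
    rw [hy, map_add, Algebra.trace_algebraMap, h2, ← Algebra.smul_def, map_smul, htr]
    simp
  have hyt : (y : K) * t = algebraMap F K (-(v0 * b)) + algebraMap F K (u0 + v0 * a) * t := by
    rw [hy]; simp only [map_neg, map_mul, map_add]
    linear_combination (algebraMap F K v0) * hqK
  have tr2 : Algebra.trace F K ((y : K) * t) = 2 * (-(v0 * b)) + (u0 + v0 * a) * a := by
    rw [hyt, map_add, Algebra.trace_algebraMap, h2, ← Algebra.smul_def, map_smul, htr]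
    simp
  have i1 : IsIntegral ℤ (Algebra.trace F K (y : K)) :=
    Algebra.isIntegral_trace y.isIntegral_coe
  have i2 : IsIntegral ℤ (Algebra.trace F K ((y : K) * t)) :=
    Algebra.isIntegral_trace (y.isIntegral_coe.mul t.isIntegral_coe)
  let T : 𝓞 F := ⟨_, i1⟩
  let S : 𝓞 F := ⟨_, i2⟩
  have hT : (T : F) = 2 * u0 + v0 * a := tr1
  have hS : (S : F) = 2 * (-(v0 * b)) + (u0 + v0 * a) * a := tr2
  refine ⟨T * (a ^ 2 - 2 * b) - a * S, 2 * S - a * T, ?_⟩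
  apply RingOfIntegers.coe_injective
  have key : ∀ x : 𝓞 F, ((algebraMap (𝓞 F) (𝓞 K) x : 𝓞 K) : K) = algebraMap F K (x : F) := by
    intro x
    rfl
  simp only [map_add, map_mul, key]
  simp only [RingOfIntegers.coe_eq_algebraMap] at hT hS hy ⊢
  simp only [map_sub, map_mul, map_pow, map_ofNat, hT, hS, map_add, map_neg]
  rw [hy]
  ring

variable (P : Ideal (𝓞 F)) [P.IsMaximal]

theorem map_rep (h2 : Module.finrank F K = 2) (t : 𝓞 K)
    (ht : ∀ c : F, algebraMap F K c ≠ (t : K)) (a b : 𝓞 F)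
    (hq : t ^ 2 - algebraMap (𝓞 F) (𝓞 K) a * t + algebraMap (𝓞 F) (𝓞 K) b = 0) (y : 𝓞 K)
    (hy : y ∈ Ideal.map (algebraMap (𝓞 F) (𝓞 K)) P) :
    ∃ u ∈ P, ∃ v ∈ P, algebraMap (𝓞 F) (𝓞 K) (a ^ 2 - 4 * b) * y =
      algebraMap (𝓞 F) (𝓞 K) u + algebraMap (𝓞 F) (𝓞 K) v * t := by
  suffices H : ∀ c : 𝓞 K, ∃ u ∈ P, ∃ v ∈ P, algebraMap (𝓞 F) (𝓞 K) (a ^ 2 - 4 * b) * (c * y) =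
      algebraMap (𝓞 F) (𝓞 K) u + algebraMap (𝓞 F) (𝓞 K) v * t by simpa using H 1
  induction hy using Submodule.span_induction with
  | mem x hx =>
    intro d
    obtain ⟨c, hc, rfl⟩ := hx
    obtain ⟨u, v, huv⟩ := disc_rep h2 t ht a b hq d
    refine ⟨u * c, P.mul_mem_left _ hc, v * c, P.mul_mem_left _ hc, ?_⟩
    rw [← mul_assoc, huv, map_mul, map_mul]; ring
  | zero => intro d; exact ⟨0, P.zero_mem, 0, P.zero_mem, by simp⟩
  | add x y _ _ hx hy =>
    intro d
    obtain ⟨u, hu, v, hv, h⟩ := hx d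
    obtain ⟨u', hu', v', hv', h'⟩ := hy d
    refine ⟨u + u', P.add_mem hu hu', v + v', P.add_mem hv hv', ?_⟩
    rw [mul_add, mul_add, h, h', map_add, map_add]; ring
  | smul c x _ hx =>
    intro d
    obtain ⟨u, hu, v, hv, h⟩ := hx (d * c)
    exact ⟨u, hu, v, hv, by rw [← h, smul_eq_mul]; ring⟩

theorem rep_uniq (t : 𝓞 K)
    (ht : ∀ c : F, algebraMap F K c ≠ (t : K)) (a b a' b' : 𝓞 F)
    (h : algebraMap (𝓞 F) (𝓞 K) a + algebraMap (𝓞 F) (𝓞 K) b * t =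
      algebraMap (𝓞 F) (𝓞 K) a' + algebraMap (𝓞 F) (𝓞 K) b' * t) : a = a' ∧ b = b' := by
  have h' := congrArg (algebraMap (𝓞 K) K) h
  simp only [map_add, map_mul] at h'
  obtain ⟨h1, h2⟩ := quad_uniq (t : K) ht (a : F) (b : F) (a' : F) (b' : F) h'
  exact ⟨RingOfIntegers.coe_injective h1, RingOfIntegers.coe_injective h2⟩

theorem exists_inv (c : 𝓞 F) (hc : c ∉ P) : ∃ k : 𝓞 F, ∃ q ∈ P, c * k = 1 + q := by
  obtain ⟨k, q, hq, h⟩ := Ideal.IsMaximal.exists_inv ‹P.IsMaximal› hc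
  exact ⟨k, -q, P.neg_mem hq, by linear_combination h⟩

theorem isMaximal_of_inv {R : Type*} [CommRing R] (Q : Ideal R) (h1 : Q ≠ ⊤)
    (h : ∀ x, x ∉ Q → ∃ y, x * y - 1 ∈ Q) : Q.IsMaximal := by
  rw [Ideal.isMaximal_iff]
  refine ⟨fun h' => h1 ((Ideal.eq_top_iff_one _).mpr h'), ?_⟩
  intro J x hQJ hx hxJ
  obtain ⟨y, hy⟩ := h x hx
  have := J.sub_mem (J.mul_mem_right y hxJ) (hQJ hy)
  simpa using this

/-- inert case -/
theorem inert_of_noroot (h2 : Module.finrank F K = 2) (t : 𝓞 K)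
    (ht : ∀ c : F, algebraMap F K c ≠ (t : K)) (a b : 𝓞 F)
    (hq : t ^ 2 - algebraMap (𝓞 F) (𝓞 K) a * t + algebraMap (𝓞 F) (𝓞 K) b = 0)
    (hd : a ^ 2 - 4 * b ∉ P) (hno : ∀ h : 𝓞 F, h ^ 2 - a * h + b ∉ P) :
    (Ideal.map (algebraMap (𝓞 F) (𝓞 K)) P).IsPrime := by
  have hmem : ∀ c ∈ P, algebraMap (𝓞 F) (𝓞 K) c ∈ Ideal.map (algebraMap (𝓞 F) (𝓞 K)) P :=
    fun c hc => Ideal.mem_map_of_mem _ hc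
  set PK := Ideal.map (algebraMap (𝓞 F) (𝓞 K)) P with hPK
  apply Ideal.IsMaximal.isPrime
  apply isMaximal_of_inv
  · intro htop
    have h1 : (1 : 𝓞 K) ∈ PK := by rw [htop]; trivial
    obtain ⟨u, hu, v, hv, h⟩ := map_rep P h2 t ht a b hq 1 h1
    obtain ⟨h3, -⟩ := rep_uniq t ht (a ^ 2 - 4 * b) 0 u v (by rw [← h]; simp)
    exact hd (h3 ▸ hu)
  · intro x hx
    obtain ⟨u, v, huv⟩ := disc_rep h2 t ht a b hq x
    by_cases hv : v ∈ P
    · have hu : u ∉ P := by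
        intro hu
        apply hx
        obtain ⟨k, q, hqP, hk⟩ := exists_inv P _ hd
        have e1 : x = algebraMap (𝓞 F) (𝓞 K) k * (algebraMap (𝓞 F) (𝓞 K) u + algebraMap (𝓞 F) (𝓞 K) v * t)
            - algebraMap (𝓞 F) (𝓞 K) q * x := by
          rw [← huv]
          have := congrArg (algebraMap (𝓞 F) (𝓞 K)) hk
          rw [map_mul, map_add, map_one] at this
          linear_combination (-x) * this
        rw [e1]
        exact PK.sub_mem (PK.mul_mem_left _ (PK.add_mem (hmem _ hu) (PK.mul_mem_right _ (hmem _ hv))))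
          (PK.mul_mem_right _ (hmem _ hqP))
      obtain ⟨k, q, hqP, hk⟩ := exists_inv P _ hu
      refine ⟨algebraMap (𝓞 F) (𝓞 K) (a ^ 2 - 4 * b) * algebraMap (𝓞 F) (𝓞 K) k, ?_⟩
      have this := congrArg (algebraMap (𝓞 F) (𝓞 K)) hk
      rw [map_mul, map_add, map_one] at this
      have e1 : x * (algebraMap (𝓞 F) (𝓞 K) (a ^ 2 - 4 * b) * algebraMap (𝓞 F) (𝓞 K) k) - 1 =
          algebraMap (𝓞 F) (𝓞 K) q + algebraMap (𝓞 F) (𝓞 K) v * (t * algebraMap (𝓞 F) (𝓞 K) k) := by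
        linear_combination algebraMap (𝓞 F) (𝓞 K) k * huv + this
      rw [e1]
      exact PK.add_mem (hmem _ hqP) (PK.mul_mem_right _ (hmem _ hv))
    · have hn : u ^ 2 + a * u * v + b * v ^ 2 ∉ P := by
        intro hn
        obtain ⟨k, q, hqP, hk⟩ := exists_inv P _ hv
        apply hno (-(u * k))
        have e1 : (-(u * k)) ^ 2 - a * (-(u * k)) + b =
            k ^ 2 * (u ^ 2 + a * u * v + b * v ^ 2) - q * (a * u * k + b * (v * k + 1)) := by
          linear_combination (-(a * u * k) - b * (v * k + 1)) * hk
        rw [e1]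
        exact P.sub_mem (P.mul_mem_left _ hn) (P.mul_mem_right _ hqP)
      obtain ⟨k, q, hqP, hk⟩ := exists_inv P _ hn
      refine ⟨algebraMap (𝓞 F) (𝓞 K) (a ^ 2 - 4 * b) * ((algebraMap (𝓞 F) (𝓞 K) (u + a * v)
        - algebraMap (𝓞 F) (𝓞 K) v * t) * algebraMap (𝓞 F) (𝓞 K) k), ?_⟩
      have this := congrArg (algebraMap (𝓞 F) (𝓞 K)) hk
      simp only [map_mul, map_add, map_one, map_pow] at this
      have e1 : x * (algebraMap (𝓞 F) (𝓞 K) (a ^ 2 - 4 * b) * ((algebraMap (𝓞 F) (𝓞 K) (u + a * v)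
        - algebraMap (𝓞 F) (𝓞 K) v * t) * algebraMap (𝓞 F) (𝓞 K) k)) - 1 =
          algebraMap (𝓞 F) (𝓞 K) q := by
        simp only [map_mul, map_add]
        linear_combination (((algebraMap (𝓞 F) (𝓞 K) u + algebraMap (𝓞 F) (𝓞 K) a * algebraMap (𝓞 F) (𝓞 K) v)
        - algebraMap (𝓞 F) (𝓞 K) v * t) * algebraMap (𝓞 F) (𝓞 K) k) * huv + this
          - (algebraMap (𝓞 F) (𝓞 K) v) ^ 2 * algebraMap (𝓞 F) (𝓞 K) k * hq
      rw [e1]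
      exact hmem _ hqP

theorem split_aux (h2 : Module.finrank F K = 2) (t : 𝓞 K)
    (ht : ∀ c : F, algebraMap F K c ≠ (t : K)) (a b : 𝓞 F)
    (hq : t ^ 2 - algebraMap (𝓞 F) (𝓞 K) a * t + algebraMap (𝓞 F) (𝓞 K) b = 0)
    (hd : a ^ 2 - 4 * b ∉ P) (h : 𝓞 F)
    (hne : Ideal.map (algebraMap (𝓞 F) (𝓞 K)) P ⊔ Ideal.span {t - algebraMap (𝓞 F) (𝓞 K) h} ≠ ⊤) :
    (Ideal.map (algebraMap (𝓞 F) (𝓞 K)) P ⊔ Ideal.span {t - algebraMap (𝓞 F) (𝓞 K) h}).IsPrime := by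
  have hmem : ∀ c ∈ P, algebraMap (𝓞 F) (𝓞 K) c ∈ Ideal.map (algebraMap (𝓞 F) (𝓞 K)) P ⊔
      Ideal.span {t - algebraMap (𝓞 F) (𝓞 K) h} :=
    fun c hc => Ideal.mem_sup_left (Ideal.mem_map_of_mem _ hc)
  have hth : t - algebraMap (𝓞 F) (𝓞 K) h ∈ Ideal.map (algebraMap (𝓞 F) (𝓞 K)) P ⊔
      Ideal.span {t - algebraMap (𝓞 F) (𝓞 K) h} :=
    Ideal.mem_sup_right (Ideal.mem_span_singleton_self _)
  set Q := Ideal.map (algebraMap (𝓞 F) (𝓞 K)) P ⊔ Ideal.span {t - algebraMap (𝓞 F) (𝓞 K) h} with hQ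
  apply Ideal.IsMaximal.isPrime
  apply isMaximal_of_inv _ hne
  intro x hx
  obtain ⟨u, v, huv⟩ := disc_rep h2 t ht a b hq x
  have hu : u + v * h ∉ P := by
    intro hu
    apply hx
    obtain ⟨k, q, hqP, hk⟩ := exists_inv P _ hd
    have e1 : x = algebraMap (𝓞 F) (𝓞 K) k * (algebraMap (𝓞 F) (𝓞 K) (u + v * h) +
        algebraMap (𝓞 F) (𝓞 K) v * (t - algebraMap (𝓞 F) (𝓞 K) h))
        - algebraMap (𝓞 F) (𝓞 K) q * x := by
      have := congrArg (algebraMap (𝓞 F) (𝓞 K)) hk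
      rw [map_mul, map_add, map_one] at this
      simp only [map_add, map_mul]
      linear_combination (-x) * this + algebraMap (𝓞 F) (𝓞 K) k * huv
    rw [e1]
    exact Q.sub_mem (Q.mul_mem_left _ (Q.add_mem (hmem _ hu) (Q.mul_mem_left _ hth)))
      (Q.mul_mem_right _ (hmem _ hqP))
  obtain ⟨k, q, hqP, hk⟩ := exists_inv P _ hu
  refine ⟨algebraMap (𝓞 F) (𝓞 K) (a ^ 2 - 4 * b) * algebraMap (𝓞 F) (𝓞 K) k, ?_⟩
  have this := congrArg (algebraMap (𝓞 F) (𝓞 K)) hk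
  simp only [map_mul, map_add, map_one] at this
  have e1 : x * (algebraMap (𝓞 F) (𝓞 K) (a ^ 2 - 4 * b) * algebraMap (𝓞 F) (𝓞 K) k) - 1 =
      algebraMap (𝓞 F) (𝓞 K) q + algebraMap (𝓞 F) (𝓞 K) v * algebraMap (𝓞 F) (𝓞 K) k *
        (t - algebraMap (𝓞 F) (𝓞 K) h) := by
    linear_combination algebraMap (𝓞 F) (𝓞 K) k * huv + this
  rw [e1]
  exact Q.add_mem (hmem _ hqP) (Q.mul_mem_left _ hth)

/-- split case -/
theorem split_of_root (h2 : Module.finrank F K = 2) (t : 𝓞 K)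
    (ht : ∀ c : F, algebraMap F K c ≠ (t : K)) (a b : 𝓞 F)
    (hq : t ^ 2 - algebraMap (𝓞 F) (𝓞 K) a * t + algebraMap (𝓞 F) (𝓞 K) b = 0)
    (hd : a ^ 2 - 4 * b ∉ P) (h : 𝓞 F) (hroot : h ^ 2 - a * h + b ∈ P) :
    ∃ Q1 Q2 : Ideal (𝓞 K), Q1.IsPrime ∧ Q2.IsPrime ∧ Q1 ≠ Q2 ∧
        Ideal.map (algebraMap (𝓞 F) (𝓞 K)) P = Q1 * Q2 := by
  set φ := algebraMap (𝓞 F) (𝓞 K) with hφ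
  set PK := Ideal.map φ P with hPK
  have hmem : ∀ c ∈ P, φ c ∈ PK := fun c hc => Ideal.mem_map_of_mem _ hc
  have hcop : IsCoprime (PK ⊔ Ideal.span {t - φ h}) (PK ⊔ Ideal.span {t - φ (a - h)}) := by
    rw [Ideal.isCoprime_iff_sup_eq, Ideal.eq_top_iff_one]
    have hP' : a - 2 * h ∉ P := by
      intro hc
      apply hd
      have : a ^ 2 - 4 * b = (a - 2 * h) * (a - 2 * h) - 4 * (h ^ 2 - a * h + b) := by ring
      rw [this]
      exact P.sub_mem (P.mul_mem_left _ hc) (P.mul_mem_left _ hroot)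
    obtain ⟨k, q, hqP, hk⟩ := exists_inv P _ hP'
    have this := congrArg φ hk
    have e1 : (1 : 𝓞 K) = (φ k * (t - φ h) + (- φ q)) + (- φ k) * (t - φ (a - h)) := by
      simp only [map_mul, map_sub, map_add, map_one, map_ofNat] at this ⊢
      linear_combination -this
    rw [e1]
    refine Ideal.add_mem _ (Ideal.mem_sup_left (Ideal.add_mem _ ?_ ?_)) (Ideal.mem_sup_right ?_)
    · exact Ideal.mem_sup_right (Ideal.mul_mem_left _ _ (Ideal.mem_span_singleton_self _))
    · exact Ideal.mem_sup_left (PK.neg_mem (hmem _ hqP))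
    · exact Ideal.mem_sup_right (Ideal.mul_mem_left _ _ (Ideal.mem_span_singleton_self _))
  have hprod : PK = (PK ⊔ Ideal.span {t - φ h}) * (PK ⊔ Ideal.span {t - φ (a - h)}) := by
    apply le_antisymm
    · rw [Ideal.mul_eq_inf_of_isCoprime hcop]
      exact le_inf le_sup_left le_sup_left
    · rw [Ideal.sup_mul, Ideal.mul_sup]
      refine sup_le (sup_le Ideal.mul_le_left Ideal.mul_le_left) ?_
      rw [Ideal.mul_sup]
      refine sup_le Ideal.mul_le_right ?_
      rw [Ideal.span_singleton_mul_span_singleton, Ideal.span_singleton_le_iff_mem]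
      have e1 : (t - φ h) * (t - φ (a - h)) = - φ (h ^ 2 - a * h + b) := by
        simp only [map_mul, map_sub, map_add, map_pow]
        linear_combination hq
      rw [e1]
      exact PK.neg_mem (hmem _ hroot)
  have hnotin : ∀ c : 𝓞 F, t - φ c ∉ PK := by
    intro c hc
    obtain ⟨u, hu, v, hv, h⟩ := map_rep P h2 t ht a b hq _ hc
    obtain ⟨-, h3⟩ := rep_uniq t ht (-((a ^ 2 - 4 * b) * c)) (a ^ 2 - 4 * b) u v (by
      rw [← h]; simp only [map_neg, map_mul]; ring)
    exact hd (h3 ▸ hv)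
  have ne1 : PK ⊔ Ideal.span {t - φ h} ≠ ⊤ := by
    intro htop
    rw [htop, Ideal.top_mul] at hprod
    apply hnotin (a - h)
    rw [hprod]
    exact Ideal.mem_sup_right (Ideal.mem_span_singleton_self _)
  have ne2 : PK ⊔ Ideal.span {t - φ (a - h)} ≠ ⊤ := by
    intro htop
    rw [htop, Ideal.mul_top] at hprod
    apply hnotin h
    rw [hprod]
    exact Ideal.mem_sup_right (Ideal.mem_span_singleton_self _)
  refine ⟨_, _, split_aux P h2 t ht a b hq hd h ne1, split_aux P h2 t ht a b hq hd (a - h) ne2, ?_, hprod⟩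
  intro heq
  rw [heq, Ideal.isCoprime_iff_sup_eq, sup_idem] at hcop
  exact ne2 hcop


theorem finish_aux (hP0 : P ≠ ⊥) (h2 : Module.finrank F K = 2) (t : 𝓞 K)
    (ht : ∀ c : F, algebraMap F K c ≠ (t : K)) (a b : 𝓞 F)
    (hq : t ^ 2 - algebraMap (𝓞 F) (𝓞 K) a * t + algebraMap (𝓞 F) (𝓞 K) b = 0)
    (hd : a ^ 2 - 4 * b ∉ P) (S I : Prop)
    (hc : ((∃ h : 𝓞 F, h ^ 2 - a * h + b ∈ P) ∧ S ∧ ¬ I) ∨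
      ((∀ h : 𝓞 F, h ^ 2 - a * h + b ∉ P) ∧ I ∧ ¬ S)) :
    ((∃ Q1 Q2 : Ideal (𝓞 K), Q1.IsPrime ∧ Q2.IsPrime ∧ Q1 ≠ Q2 ∧
        Ideal.map (algebraMap (𝓞 F) (𝓞 K)) P = Q1 * Q2) ↔ S) ∧
    ((Ideal.map (algebraMap (𝓞 F) (𝓞 K)) P).IsPrime ↔ I) := by
  have hexc : (∃ Q1 Q2 : Ideal (𝓞 K), Q1.IsPrime ∧ Q2.IsPrime ∧ Q1 ≠ Q2 ∧
        Ideal.map (algebraMap (𝓞 F) (𝓞 K)) P = Q1 * Q2) →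
        ¬ (Ideal.map (algebraMap (𝓞 F) (𝓞 K)) P).IsPrime := by
    rintro ⟨Q1, Q2, h1, h2, h3, h4⟩ hpr
    have hne : Ideal.map (algebraMap (𝓞 F) (𝓞 K)) P ≠ ⊥ := by
      rw [Ne, Ideal.map_eq_bot_iff_of_injective (FaithfulSMul.algebraMap_injective _ _)]
      exact hP0
    rw [h4] at hpr hne
    have hm1 : Q1 ≠ ⊥ := by rintro rfl; simp at hne
    have hm2 : Q2 ≠ ⊥ := by rintro rfl; simp at hne
    have hmax : (Q1 * Q2).IsMaximal := hpr.isMaximal hne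
    have e1 := hmax.eq_of_le h1.ne_top Ideal.mul_le_left
    have e2 := hmax.eq_of_le h2.ne_top Ideal.mul_le_right
    exact h3 (e1.symm.trans e2)
  rcases hc with ⟨⟨h, hh⟩, hS, hI⟩ | ⟨hh, hI, hS⟩
  · have := split_of_root P h2 t ht a b hq hd h hh
    exact ⟨⟨fun _ => hS, fun _ => this⟩, ⟨fun h => absurd h (hexc this), fun h => absurd h hI⟩⟩
  · have := inert_of_noroot P h2 t ht a b hq hd hh
    exact ⟨⟨fun h => absurd this (hexc h), fun h => absurd h hS⟩, ⟨fun _ => hI, fun _ => this⟩⟩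

theorem ram_aux (hP0 : P ≠ ⊥) (h2P : (2 : 𝓞 F) ∈ P) (h2P2 : (2 : 𝓞 F) ∉ P ^ 2)
    (hdiff : ¬ Ideal.relNorm (𝓞 F) (differentIdeal (𝓞 F) (𝓞 K)) ≤ P)
    (t : 𝓞 K) (β : 𝓞 F) (ht : t ^ 2 = algebraMap (𝓞 F) (𝓞 K) β) (hβ : β + 1 ∈ P ^ 2) : False := by
  set φ := algebraMap (𝓞 F) (𝓞 K) with hφ
  obtain ⟨Q, hQmax, hQ⟩ := Ideal.exists_maximal_ideal_liesOver_of_isIntegral (S := 𝓞 K) P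
  have hcomap : Q.comap φ = P := hQ.over.symm
  have hle : Ideal.map φ P ≤ Q := Ideal.map_le_iff_le_comap.mpr hcomap.ge
  have hmem : ∀ c ∈ P, φ c ∈ Q := fun c hc => hle (Ideal.mem_map_of_mem _ hc)
  have hmem2 : ∀ c ∈ P ^ 2, φ c ∈ Q ^ 2 := fun c hc =>
    Ideal.pow_right_mono hle 2 (by rw [← Ideal.map_pow]; exact Ideal.mem_map_of_mem _ hc)
  have hQ2 : φ 2 ∈ Q := hmem _ h2P
  -- t + 1 ∈ Q
  have hbq : φ (β + 1) ∈ Q := Ideal.pow_le_self two_ne_zero (hmem2 _ hβ)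
  have hg2 : (t + 1) ^ 2 = φ 2 * (t + 1) - φ 2 + φ (β + 1) := by
    simp only [map_add, map_one, map_ofNat]
    linear_combination ht
  have hg : t + 1 ∈ Q := by
    apply hQmax.isPrime.mem_of_pow_mem 2
    rw [hg2]
    exact Q.add_mem (Q.sub_mem (Q.mul_mem_right _ hQ2) hQ2) hbq
  have h2Q2 : φ 2 ∈ Q ^ 2 := by
    have : φ 2 = φ 2 * (t + 1) + φ (β + 1) - (t + 1) ^ 2 := by linear_combination hg2
    rw [this]
    refine Ideal.sub_mem _ (Ideal.add_mem _ ?_ (hmem2 _ hβ)) (Ideal.pow_mem_pow hg 2)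
    rw [pow_two]; exact Ideal.mul_mem_mul hQ2 hg
  have hPne : (Q ^ 2) ∣ Ideal.map φ P := by
    have hd : P ∣ Ideal.span {(2 : 𝓞 F)} := by
      rw [Ideal.dvd_iff_le, Ideal.span_singleton_le_iff_mem]; exact h2P
    obtain ⟨I, hI⟩ := hd
    have hIP : ¬ I ≤ P := by
      intro hIP
      apply h2P2
      have : (2 : 𝓞 F) ∈ P * I := by rw [← hI]; exact Ideal.mem_span_singleton_self _
      rw [pow_two]
      exact Ideal.mul_mono_right hIP this
    obtain ⟨i, hi, hiP⟩ := SetLike.not_le_iff_exists.mp hIP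
    rw [Ideal.dvd_iff_le, Ideal.map_le_iff_le_comap]
    intro x hx
    rw [Ideal.mem_comap]
    have hxi : x * i ∈ Ideal.span {(2 : 𝓞 F)} := by rw [hI]; exact Ideal.mul_mem_mul hx hi
    obtain ⟨k, hk⟩ := Ideal.mem_span_singleton.mp hxi
    have : φ i * φ x ∈ Q ^ 2 := by
      rw [← map_mul, mul_comm, hk, map_mul]
      exact Ideal.mul_mem_right _ _ h2Q2
    rcases Ideal.IsPrime.mul_mem_pow Q this with h | h
    · exact absurd (by rw [← hcomap]; exact h) hiP
    · exact h
  have hdd := pow_sub_one_dvd_differentIdeal (𝓞 F) Q 2 hP0 hPne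
  apply hdiff
  rw [show 2 - 1 = 1 from rfl, pow_one, Ideal.dvd_iff_le] at hdd
  calc _ ≤ Ideal.relNorm (𝓞 F) Q := Ideal.relNorm_mono _ hdd
    _ ≤ Q.comap φ := Ideal.relNorm_le_comap _ _
    _ = P := hcomap

end QuadSplit

section QuadField
variable {F : Type*} [Field F] [NumberField F]

theorem int_basis (h2 : Module.finrank ℚ F = 2) (Dt : ℤ) (hsf : Squarefree Dt)
    (r : 𝓞 F) (hr : r ^ 2 = (Dt : 𝓞 F)) (hrn : ∀ c : ℚ, algebraMap ℚ F c ≠ (r : F))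
    (x : 𝓞 F) : ∃ u v : ℤ, 2 * x = u + v * r := by
  obtain ⟨a, b, hx⟩ := quad_rep h2 (r : F) hrn (x : F)
  have hrF : (r : F) ^ 2 = (Dt : F) := by
    have := congrArg (algebraMap (𝓞 F) F) hr
    simpa using this
  have htr := quad_trace h2 (r : F) hrn 0 (-Dt) (by simp; linear_combination hrF)
  have tr1 : Algebra.trace ℚ F (x : F) = 2 * a := by
    rw [hx, map_add, Algebra.trace_algebraMap, h2, ← Algebra.smul_def, map_smul, htr]
    simp
  have i1 : IsIntegral ℤ (Algebra.trace ℚ F (x : F)) :=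
    Algebra.isIntegral_trace x.isIntegral_coe
  obtain ⟨u, hu⟩ := IsIntegrallyClosed.isIntegral_iff.mp i1
  rw [tr1] at hu
  have hu' : (u : ℚ) = 2 * a := by simpa using hu
  -- (2x - u)^2 = 4 b^2 Dt
  have i2 : IsIntegral ℤ ((2 * b) ^ 2 * Dt : ℚ) := by
    rw [← isIntegral_algebraMap_iff (algebraMap ℚ F).injective]
    have : algebraMap ℚ F ((2 * b) ^ 2 * Dt : ℚ) = (((2 * x - u) ^ 2 : 𝓞 F) : F) := by
      have h3 : (u : F) = 2 * algebraMap ℚ F a := by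
        have := congrArg (algebraMap ℚ F) hu'
        simpa using this
      simp only [map_mul, map_pow, map_sub, map_ofNat, map_intCast]
      simp only [RingOfIntegers.coe_eq_algebraMap] at hx hrF
      rw [hx, h3]
      linear_combination (-4 * (algebraMap ℚ F b) ^ 2) * hrF
    rw [this]
    exact RingOfIntegers.isIntegral_coe _
  obtain ⟨M, hM⟩ := IsIntegrallyClosed.isIntegral_iff.mp i2
  have hM' : (M : ℚ) = (2 * b) ^ 2 * Dt := by simpa using hM
  have hDt0 : Dt ≠ 0 := hsf.ne_zero
  have i3 : ∃ v : ℤ, (v : ℚ) = 2 * b := by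
    -- numerator/denominator
    set q : ℚ := 2 * b with hq
    have hden : (q.den : ℚ) ≠ 0 := by exact_mod_cast q.den_ne_zero
    have hqe : q * q.den = q.num := Rat.mul_den_eq_num q
    have e1 : M * (q.den : ℤ) ^ 2 = q.num ^ 2 * Dt := by
      have : (M : ℚ) * (q.den : ℚ) ^ 2 = (q.num : ℚ) ^ 2 * Dt := by
        rw [hM', ← hqe]; ring
      exact_mod_cast this
    have hcop : IsCoprime ((q.den : ℤ) ^ 2) (q.num ^ 2) := by
      apply IsCoprime.pow
      rw [Int.isCoprime_iff_gcd_eq_one]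
      have := q.reduced
      rw [Nat.Coprime, Nat.gcd_comm] at this
      simpa [Int.gcd] using this
    have hdvd : (q.den : ℤ) ^ 2 ∣ Dt := hcop.dvd_of_dvd_mul_left ⟨M, by linear_combination -e1⟩
    have hun : IsUnit (q.den : ℤ) := hsf _ (by rw [← pow_two]; exact hdvd)
    have hd1 : q.den = 1 := by
      have := Int.isUnit_iff.mp hun
      omega
    exact ⟨q.num, by rw [← hqe, hd1]; simp⟩
  obtain ⟨v, hv⟩ := i3
  refine ⟨u, v, ?_⟩
  apply RingOfIntegers.coe_injective
  have h3 : (u : F) = 2 * algebraMap ℚ F a := by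
    have := congrArg (algebraMap ℚ F) hu'
    simpa using this
  have h4 : (v : F) = 2 * algebraMap ℚ F b := by
    have := congrArg (algebraMap ℚ F) hv
    simpa using this
  simp only [map_mul, map_add, map_ofNat, map_intCast]
  simp only [RingOfIntegers.coe_eq_algebraMap] at hx hrF
  rw [hx, h3, h4]
  ring

theorem int_of_two_mul (x : 𝓞 F) (a : ℤ) (h : 2 * x = (a : 𝓞 F)) : ∃ k : ℤ, a = 2 * k := by
  have h1 : (x : F) = algebraMap ℚ F ((a : ℚ) / 2) := by
    have := congrArg (algebraMap (𝓞 F) F) h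
    simp only [map_mul, map_ofNat, map_intCast] at this
    simp only [map_div₀, map_intCast, map_ofNat]
    rw [eq_div_iff two_ne_zero, mul_comm]
    exact this
  have h2 : IsIntegral ℤ ((a : ℚ) / 2) := by
    rw [← isIntegral_algebraMap_iff (algebraMap ℚ F).injective, ← h1]
    exact x.isIntegral_coe
  obtain ⟨k, hk⟩ := IsIntegrallyClosed.isIntegral_iff.mp h2
  refine ⟨k, ?_⟩
  have : (a : ℚ) = 2 * k := by
    have : (k : ℚ) = a / 2 := by simpa using hk
    rw [this]; ring
  exact_mod_cast this

theorem int_basis' (h2 : Module.finrank ℚ F = 2) (Dt : ℤ) (hsf : Squarefree Dt)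
    (r : 𝓞 F) (hr : r ^ 2 = (Dt : 𝓞 F)) (hrn : ∀ c : ℚ, algebraMap ℚ F c ≠ (r : F))
    (ω : 𝓞 F) (hω : 2 * ω = 1 + r)
    (x : 𝓞 F) : ∃ u v : ℤ, x = u + v * ω := by
  obtain ⟨u, v, huv⟩ := int_basis h2 Dt hsf r hr hrn x
  obtain ⟨k, hk⟩ := int_of_two_mul (x - (v : 𝓞 F) * ω) (u - v) (by
    push_cast
    linear_combination huv - (v : 𝓞 F) * hω)
  refine ⟨k, v, ?_⟩
  have h2' : (2 : 𝓞 F) ≠ 0 := two_ne_zero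
  apply mul_left_cancel₀ h2'
  have : (u : 𝓞 F) - v = 2 * k := by exact_mod_cast congrArg (Int.cast : ℤ → 𝓞 F) hk
  linear_combination huv - (v : 𝓞 F) * hω + this

theorem exists_omega (Dt : ℤ) (h4 : Dt % 4 = 1) (r : 𝓞 F) (hr : r ^ 2 = (Dt : 𝓞 F)) :
    ∃ ω : 𝓞 F, 2 * ω = 1 + r := by
  obtain ⟨c, hc⟩ : ∃ c : ℤ, Dt = 1 + 4 * c := ⟨Dt / 4, by omega⟩
  have hi : IsIntegral (𝓞 F) ((1 + (r : F)) / 2) := by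
    have hrF : algebraMap (𝓞 F) F r ^ 2 = 1 + 4 * (c : F) := by
      have := congrArg (algebraMap (𝓞 F) F) hr
      rw [hc] at this
      simp only [map_pow, map_intCast] at this
      push_cast at this
      exact this
    apply integral_of_quad _ (1 : 𝓞 F) (-(c : 𝓞 F))
    simp only [RingOfIntegers.coe_eq_algebraMap, map_neg, map_one, map_intCast] at hrF ⊢
    linear_combination hrF / 4
  obtain ⟨ω, hω⟩ := IsIntegrallyClosed.isIntegral_iff.mp hi
  refine ⟨ω, RingOfIntegers.coe_injective ?_⟩
  simp only [map_mul, map_add, map_ofNat, map_one, hω]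
  simp only [RingOfIntegers.coe_eq_algebraMap]
  ring

theorem two_not_mem_sq (h2 : Module.finrank ℚ F = 2) (Dt : ℤ) (hsf : Squarefree Dt)
    (h4 : Dt % 4 = 1)
    (r : 𝓞 F) (hr : r ^ 2 = (Dt : 𝓞 F)) (hrn : ∀ c : ℚ, algebraMap ℚ F c ≠ (r : F))
    (P : Ideal (𝓞 F)) [P.IsPrime] : (2 : 𝓞 F) ∉ P ^ 2 := by
  intro hmem
  obtain ⟨ω, hω⟩ := exists_omega Dt h4 r hr
  obtain ⟨c, hc⟩ : ∃ c : ℤ, Dt = 1 + 4 * c := ⟨Dt / 4, by omega⟩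
  have hω2 : ω ^ 2 = ω + c := by
    have h4' : (4 : 𝓞 F) ≠ 0 := OfNat.ofNat_ne_zero 4
    apply mul_left_cancel₀ h4'
    rw [hc] at hr
    push_cast at hr
    linear_combination (2 * ω - 1 + r) * hω + hr
  have hωn : ∀ q : ℚ, algebraMap ℚ F q ≠ (ω : F) := by
    intro q hq
    apply hrn (2 * q - 1)
    have := congrArg (algebraMap (𝓞 F) F) hω
    simp only [map_mul, map_add, map_ofNat, map_one] at this
    simp only [map_sub, map_mul, map_ofNat, map_one, hq]
    simp only [RingOfIntegers.coe_eq_algebraMap]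
    linear_combination this
  have hrad : ∀ x : 𝓞 F, x ^ 2 ∈ Ideal.span {(2 : 𝓞 F)} → x ∈ Ideal.span {(2 : 𝓞 F)} := by
    intro x hx
    obtain ⟨y, hy⟩ := Ideal.mem_span_singleton.mp hx
    obtain ⟨a, v, rfl⟩ := int_basis' h2 Dt hsf r hr hrn ω hω x
    obtain ⟨a', v', rfl⟩ := int_basis' h2 Dt hsf r hr hrn ω hω y
    have heq : ((a ^ 2 + v ^ 2 * c : ℤ) : 𝓞 F) + ((2 * a * v + v ^ 2 : ℤ) : 𝓞 F) * ω =
        ((2 * a' : ℤ) : 𝓞 F) + ((2 * v' : ℤ) : 𝓞 F) * ω := by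
      push_cast
      linear_combination hy - (v : 𝓞 F) ^ 2 * hω2
    have heqF := congrArg (algebraMap (𝓞 F) F) heq
    simp only [map_add, map_mul, map_intCast] at heqF
    obtain ⟨e1, e2⟩ := quad_uniq (F := ℚ) (ω : F) hωn ((a ^ 2 + v ^ 2 * c : ℤ) : ℚ)
      ((2 * a * v + v ^ 2 : ℤ) : ℚ) ((2 * a' : ℤ) : ℚ) ((2 * v' : ℤ) : ℚ) (by
        simp only [map_intCast]; exact heqF)
    have e1' : a ^ 2 + v ^ 2 * c = 2 * a' := by exact_mod_cast e1
    have e2' : 2 * a * v + v ^ 2 = 2 * v' := by exact_mod_cast e2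
    have hv : Even v := by
      have : Even (v ^ 2) := ⟨v' - a * v, by linear_combination e2'⟩
      exact (Int.even_pow.mp this).1
    obtain ⟨v1, hv1⟩ := hv
    have ha : Even a := by
      have : Even (a ^ 2) := ⟨a' - 2 * v1 ^ 2 * c, by subst hv1; linear_combination e1'⟩
      exact (Int.even_pow.mp this).1
    obtain ⟨a1, ha1⟩ := ha
    rw [Ideal.mem_span_singleton]
    exact ⟨a1 + v1 * ω, by rw [hv1, ha1]; push_cast; ring⟩
  have hd : P ^ 2 ∣ Ideal.span {(2 : 𝓞 F)} := by
    rw [Ideal.dvd_iff_le, Ideal.span_singleton_le_iff_mem]; exact hmem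
  obtain ⟨I, hI⟩ := hd
  have hle : P * I ≤ P ^ 2 * I := by
    intro x hx
    rw [← hI]
    apply hrad
    rw [hI, pow_two, pow_two]
    have : x * x ∈ (P * I) * (P * I) := Ideal.mul_mem_mul hx hx
    have h3 : (P * I) * (P * I) ≤ P * P * I := by
      have : (P * I) * (P * I) = (P * P * I) * I := by ring
      rw [this]; exact Ideal.mul_le_left
    exact h3 this
  have hne : Ideal.span {(2 : 𝓞 F)} ≠ ⊥ := by simp
  have hPI : P * I ≠ 0 := by
    intro h0
    apply hne
    rw [hI, pow_two, mul_assoc, h0, mul_zero]; rfl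
  rw [pow_two, mul_assoc, ← Ideal.dvd_iff_le] at hle
  obtain ⟨J, hJ⟩ := hle
  have hJ1 : P * J = 1 := by
    apply mul_left_cancel₀ hPI
    rw [mul_one]
    calc _ = P * (P * I) * J := by ring
      _ = _ := hJ.symm
  have htop : P = ⊤ := by
    rw [eq_top_iff, ← Ideal.one_eq_top, ← hJ1]; exact Ideal.mul_le_left
  exact Ideal.IsPrime.ne_top ‹_› htop

end QuadField

section Cores
variable {F K : Type*} [Field F] [NumberField F] [Field K] [NumberField K] [Algebra F K]

def SplitConcl (K : Type*) [Field K] [NumberField K] [Algebra F K] (P : Ideal (𝓞 F)) (S I : Prop) : Prop :=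
    ((∃ Q1 Q2 : Ideal (𝓞 K), Q1.IsPrime ∧ Q2.IsPrime ∧ Q1 ≠ Q2 ∧
        Ideal.map (algebraMap (𝓞 F) (𝓞 K)) P = Q1 * Q2) ↔ S) ∧
    ((Ideal.map (algebraMap (𝓞 F) (𝓞 K)) P).IsPrime ↔ I)

theorem int_mem_iff (P : Ideal (𝓞 F)) [P.IsMaximal] (p : ℕ) (hp : p.Prime) (hpP : (p : 𝓞 F) ∈ P)
    (k : ℤ) : (k : 𝓞 F) ∈ P ↔ (p : ℤ) ∣ k := by
  constructor
  · intro hk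
    by_contra hnd
    have hcop : IsCoprime (p : ℤ) k :=
      (Prime.coprime_iff_not_dvd (Nat.prime_iff_prime_int.mp hp)).mpr hnd
    obtain ⟨x, y, hxy⟩ := hcop
    have : (1 : 𝓞 F) ∈ P := by
      have e : (1 : 𝓞 F) = x * (p : 𝓞 F) + y * (k : 𝓞 F) := by
        have := congrArg (Int.cast : ℤ → 𝓞 F) hxy
        push_cast at this
        exact this.symm
      rw [e]
      exact P.add_mem (P.mul_mem_left _ hpP) (P.mul_mem_left _ hk)
    exact Ideal.IsMaximal.ne_top ‹P.IsMaximal› ((Ideal.eq_top_iff_one _).mpr this)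
  · rintro ⟨c, rfl⟩
    push_cast
    exact P.mul_mem_right _ hpP

theorem odd_core (P : Ideal (𝓞 F)) [P.IsMaximal] (hP0 : P ≠ ⊥) (h2 : Module.finrank F K = 2)
    (p : ℕ) [hp : Fact p.Prime] (hp2 : p ≠ 2) (hpP : (p : 𝓞 F) ∈ P)
    (hres : ∀ y : 𝓞 F, ∃ h : ℤ, y - h ∈ P)
    (t : 𝓞 K) (ht : ∀ c : F, algebraMap F K c ≠ (t : K)) (β : 𝓞 F)
    (hβ : t ^ 2 = algebraMap (𝓞 F) (𝓞 K) β) (g : ℤ) (hg : β - g ∈ P) (hpg : ¬ (p : ℤ) ∣ g)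
    (S I : Prop) (hS : S ↔ legendreSym p g = 1) (hI : I ↔ legendreSym p g = -1) :
    SplitConcl K P S I := by
  have hmem := int_mem_iff P p hp.out hpP
  have hg0 : ((g : ℤ) : ZMod p) ≠ 0 := by
    rwa [Ne, ZMod.intCast_zmod_eq_zero_iff_dvd]
  apply finish_aux P hP0 h2 t ht 0 (-β) (by simp [hβ])
  · intro h
    have h4 : ((4 * g : ℤ) : 𝓞 F) ∈ P := by
      have e : ((4 * g : ℤ) : 𝓞 F) = (0 ^ 2 - 4 * -β) - 4 * (β - g) := by push_cast; ring
      rw [e]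
      exact P.sub_mem h (P.mul_mem_left _ hg)
    rw [hmem] at h4
    rcases Int.Prime.dvd_mul' hp.out h4 with h5 | h5
    · have h6 : p ∣ 2 ^ 2 := by exact_mod_cast h5
      have := hp.out.dvd_of_dvd_pow h6
      exact hp2 ((Nat.prime_dvd_prime_iff_eq hp.out Nat.prime_two).mp this)
    · exact hpg h5
  · have hiff : (∃ h : 𝓞 F, h ^ 2 - 0 * h + -β ∈ P) ↔ legendreSym p g = 1 := by
      rw [legendreSym.eq_one_iff p hg0]
      constructor
      · rintro ⟨y, hy⟩
        obtain ⟨h, hh⟩ := hres y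
        have h3 : ((h ^ 2 - g : ℤ) : 𝓞 F) ∈ P := by
          have e : ((h ^ 2 - g : ℤ) : 𝓞 F) = (y ^ 2 - 0 * y + -β) + (β - g) - (y + h) * (y - h) := by
            push_cast; ring
          rw [e]
          exact P.sub_mem (P.add_mem hy hg) (P.mul_mem_left _ hh)
        rw [hmem, ← ZMod.intCast_zmod_eq_zero_iff_dvd] at h3
        push_cast at h3
        exact ⟨(h : ZMod p), by linear_combination -h3⟩
      · rintro ⟨x, hx⟩
        obtain ⟨h, rfl⟩ := ZMod.intCast_surjective x
        have h3 : ((h ^ 2 - g : ℤ) : ZMod p) = 0 := by push_cast; linear_combination -hx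
        rw [ZMod.intCast_zmod_eq_zero_iff_dvd, ← hmem] at h3
        refine ⟨h, ?_⟩
        have e : (h : 𝓞 F) ^ 2 - 0 * h + -β = ((h ^ 2 - g : ℤ) : 𝓞 F) - (β - g) := by push_cast; ring
        rw [e]
        exact P.sub_mem h3 hg
    rcases legendreSym.eq_one_or_neg_one p hg0 with h | h
    · left
      refine ⟨hiff.mpr h, hS.mpr h, ?_⟩
      rw [hI, h]; norm_num
    · right
      refine ⟨?_, hI.mpr h, ?_⟩
      · rw [← not_exists, hiff, h]; norm_num
      · rw [hS, h]; norm_num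

theorem even_core (P : Ideal (𝓞 F)) [P.IsMaximal] (hP0 : P ≠ ⊥) (h2 : Module.finrank F K = 2)
    (hpP : (2 : 𝓞 F) ∈ P)
    (hres : ∀ y : 𝓞 F, ∃ h : ℤ, y - h ∈ P)
    (t : 𝓞 K) (ht : ∀ c : F, algebraMap F K c ≠ (t : K)) (a g : 𝓞 F)
    (hβ : t ^ 2 = algebraMap (𝓞 F) (𝓞 K) (a ^ 2 + 4 * g)) (a0 g0 : ℤ) (ha : a - a0 ∈ P)
    (hg : g - g0 ∈ P) (ha0 : a0 % 2 = 1)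
    (S I : Prop) (hS : S ↔ g0 % 2 = 0) (hI : I ↔ g0 % 2 = 1) :
    SplitConcl K P S I := by
  have hmem := int_mem_iff P 2 Nat.prime_two (by simpa using hpP)
  have htK : algebraMap (𝓞 K) K t ^ 2 = algebraMap (𝓞 F) K a ^ 2 + 4 * algebraMap (𝓞 F) K g := by
    have := congrArg (algebraMap (𝓞 K) K) hβ
    rw [← IsScalarTower.algebraMap_apply] at this
    simpa only [map_pow, map_add, map_mul, map_ofNat] using this
  have hi : IsIntegral (𝓞 F) ((algebraMap (𝓞 K) K t + algebraMap (𝓞 F) K a) / 2) := by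
    apply integral_of_quad _ a (-g)
    rw [map_neg]
    linear_combination htK / 4
  have hi' : IsIntegral (𝓞 K) ((algebraMap (𝓞 K) K t + algebraMap (𝓞 F) K a) / 2) := hi.tower_top
  obtain ⟨θ, hθ⟩ := IsIntegrallyClosed.isIntegral_iff.mp hi'
  apply finish_aux P hP0 h2 θ (a := a) (b := -g)
  · intro c hc
    apply ht (2 * c - algebraMap (𝓞 F) F a)
    rw [map_sub, map_mul, hc, ← IsScalarTower.algebraMap_apply, map_ofNat]
    simp only [RingOfIntegers.coe_eq_algebraMap]
    rw [hθ]; ring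
  · apply RingOfIntegers.coe_injective
    simp only [map_add, map_sub, map_mul, map_pow, map_zero, map_neg, ← IsScalarTower.algebraMap_apply, hθ]
    linear_combination htK / 4
  · intro h
    have h3 : ((a0 ^ 2 : ℤ) : 𝓞 F) ∈ P := by
      have e : ((a0 ^ 2 : ℤ) : 𝓞 F) = (a ^ 2 - 4 * -g) - (a + a0) * (a - a0) - 2 * (2 * g) := by
        push_cast; ring
      rw [e]
      exact P.sub_mem (P.sub_mem h (P.mul_mem_left _ ha)) (P.mul_mem_right _ hpP)
    rw [hmem] at h3
    have := Int.Prime.dvd_pow' Nat.prime_two h3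
    omega
  · have key : ∀ (y : 𝓞 F) (h : ℤ), y - h ∈ P → (y ^ 2 - a * y + -g ∈ P ↔ g0 % 2 = 0) := by
      intro y h hh
      have e : y ^ 2 - a * y + -g = ((h ^ 2 - a0 * h - g0 : ℤ) : 𝓞 F) + ((y + h - a0) * (y - h)
        - y * (a - a0) - (g - g0)) := by push_cast; ring
      have hm : (y + h - a0) * (y - h) - y * (a - a0) - (g - g0) ∈ P :=
        P.sub_mem (P.sub_mem (P.mul_mem_left _ hh) (P.mul_mem_left _ ha)) hg
      rw [e, Ideal.add_mem_iff_left _ hm, hmem]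
      obtain ⟨k, hk⟩ : ∃ k, a0 = 2 * k + 1 := ⟨a0 / 2, by omega⟩
      obtain ⟨l, hl⟩ := Int.even_mul_pred_self h
      have : h ^ 2 - a0 * h - g0 = 2 * (l - k * h) - g0 := by
        subst hk; linear_combination hl
      rw [this]
      push_cast
      omega
    rcases Int.emod_two_eq_zero_or_one g0 with h | h
    · left
      refine ⟨⟨0, (key 0 0 (by simp)).mpr h⟩, hS.mpr h, ?_⟩
      rw [hI]; omega
    · right
      refine ⟨?_, hI.mpr h, by rw [hS]; omega⟩
      intro y
      obtain ⟨k, hk⟩ := hres y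
      rw [key y k hk]; omega

end Cores

theorem Dt_ne_one (D A2 B2 Dt cK δ s n NN : ℤ) (hDp : Prime D) (hDpos : 0 < D) (hD4 : D % 4 = 1)
    (hDt : 4 * Dt = A2 ^ 2 - B2 ^ 2 * D) (hcKA : D ∣ 2 * cK - A2) (hδ : 0 < δ)
    (hs : D - 4 * δ = s ^ 2) (hn : (2 * D) ∣ (n + cK * δ))
    (hNN : 4 * D * NN = δ ^ 2 * Dt - n ^ 2) (hNNpos : 0 < NN) : Dt ≠ 1 := by
  rintro rfl
  obtain ⟨a, ha⟩ := hcKA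
  obtain ⟨b, hb⟩ := hn
  have h1 : D ∣ (2 * 2) * ((cK - 1) * (cK + 1)) := by
    refine ⟨a * (2 * cK + A2) + B2 ^ 2, ?_⟩
    linear_combination (2 * cK + A2) * ha - hDt
  have hlt : n ^ 2 < δ ^ 2 := by nlinarith [mul_pos hDpos hNNpos]
  have habs := abs_lt_of_sq_lt_sq hlt hδ.le
  rw [abs_lt] at habs
  have hDd : 4 * δ ≤ D := by nlinarith [sq_nonneg s]
  have hn2 : ¬ D ∣ 2 := by
    intro h
    have := Int.le_of_dvd (by norm_num) h
    have : D = 1 := by omega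
    subst this
    exact hDp.not_isUnit isUnit_one
  have hz : ∀ x : ℤ, D ∣ x → -D < x → x < D → x = 0 := by
    intro x hx h1 h2
    exact Int.eq_zero_of_abs_lt_dvd hx (abs_lt.mpr ⟨h1, h2⟩)
  rcases hDp.dvd_or_dvd h1 with h | h
  · rcases hDp.dvd_or_dvd h with h | h <;> exact hn2 h
  rcases hDp.dvd_or_dvd h with ⟨c, hc⟩ | ⟨c, hc⟩
  · have : n + δ = 0 := hz _ ⟨2 * b - c * δ, by linear_combination hb - δ * hc⟩ (by linarith) (by linarith)
    linarith
  · have : n - δ = 0 := hz _ ⟨2 * b - c * δ, by linear_combination hb - δ * hc⟩ (by linarith) (by linarith)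
    linarith

theorem not_sq_of_sf (Dt : ℤ) (hsf : Squarefree Dt) (h1 : Dt ≠ 1) : ¬ IsSquare Dt := by
  rintro ⟨k, hk⟩
  have := hsf k ⟨1, by rw [hk]; ring⟩
  rcases Int.isUnit_iff.mp this with h | h <;> (rw [h] at hk; norm_num at hk; exact h1 hk)

theorem r_not_rat {F : Type*} [Field F] [NumberField F] (Dt : ℤ) (hns : ¬ IsSquare Dt) (r : F)
    (hr : r ^ 2 = (Dt : F)) (c : ℚ) : algebraMap ℚ F c ≠ r := by
  rintro rfl
  apply hns
  rw [← Rat.isSquare_intCast_iff]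
  refine ⟨c, (algebraMap ℚ F).injective ?_⟩
  rw [map_mul, ← pow_two, hr]; simp

theorem w_not_F {F K : Type*} [Field F] [NumberField F] [Field K] [NumberField K] [Algebra F K]
    (hrF : Module.finrank ℚ F = 2)
    (D A2 B2 Dt : ℤ) (hDp : Prime D) 
    (hDt : 4 * Dt = A2 ^ 2 - B2 ^ 2 * D) (hB2 : B2 ≠ 0) (r : F)
    (hr : r ^ 2 = (Dt : F)) (hrn : ∀ c : ℚ, algebraMap ℚ F c ≠ r) 
    (w : K) (hw : w ^ 2 = algebraMap F K ((A2 : F) + 2 * r)) (c : F) : algebraMap F K c ≠ w := by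
  rintro rfl
  rw [← map_pow] at hw
  have hc := (algebraMap F K).injective hw
  obtain ⟨x, y, rfl⟩ := quad_rep hrF r hrn c
  obtain ⟨e1, e2⟩ := quad_uniq (F := ℚ) r hrn (x ^ 2 + y ^ 2 * Dt) (2 * x * y) (A2 : ℚ) 2 (by
    simp only [map_add, map_mul, map_pow, map_intCast, map_ofNat]
    linear_combination hc - (algebraMap ℚ F y) ^ 2 * hr)
  have hDtQ : (4 * Dt : ℚ) = A2 ^ 2 - B2 ^ 2 * D := by exact_mod_cast hDt
  have hB : (B2 : ℚ) ≠ 0 := by exact_mod_cast hB2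
  have hxy : x * y = 1 := by linear_combination e2 / 2
  have h3 : (x ^ 2 - y ^ 2 * Dt) ^ 2 = (B2 : ℚ) ^ 2 * D := by
    rw [← e1] at hDtQ
    linear_combination -hDtQ - 4 * (Dt : ℚ) * (x * y + 1) * hxy
  have hsq : IsSquare D := by
    rw [← Rat.isSquare_intCast_iff]
    refine ⟨(x ^ 2 - y ^ 2 * Dt) / B2, ?_⟩
    field_simp
    linear_combination -h3
  obtain ⟨k, hk⟩ := hsq
  exact hDp.irreducible.not_isSquare ⟨k, hk⟩

theorem t_helper {F K : Type*} [Field F] [NumberField F] [Field K] [NumberField K] [Algebra F K]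
    (W : K) (hW : ∀ c : F, algebraMap F K c ≠ W) (γ : F) (hγ : W ^ 2 = algebraMap F K γ)
    (β : 𝓞 F) (q : F) (hq : q ≠ 0) (hβ : algebraMap (𝓞 F) F β = q ^ 2 * γ) :
    ∃ t : 𝓞 K, t ^ 2 = algebraMap (𝓞 F) (𝓞 K) β ∧ ∀ c : F, algebraMap F K c ≠ (t : K) := by
  have hsq : (algebraMap F K q * W) ^ 2 = algebraMap (𝓞 F) K β := by
    rw [IsScalarTower.algebraMap_apply (𝓞 F) F K, hβ, map_mul, map_pow, ← hγ]; ring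
  have hi : IsIntegral (𝓞 F) (algebraMap F K q * W) := by
    apply integral_of_quad _ 0 (-β)
    rw [map_neg, map_zero]
    linear_combination hsq
  obtain ⟨t, ht⟩ := IsIntegrallyClosed.isIntegral_iff.mp (hi.tower_top (A := 𝓞 K))
  refine ⟨t, ?_, ?_⟩
  · apply RingOfIntegers.coe_injective
    rw [map_pow, ht, hsq, ← IsScalarTower.algebraMap_apply]
  · intro c hc
    have hq' : algebraMap F K q ≠ 0 := (map_ne_zero _).mpr hq
    apply hW (c / q)
    rw [map_div₀, hc, div_eq_iff hq', mul_comm]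
    exact ht

theorem z_exists {F : Type*} [Field F] [NumberField F] (D n δ : ℤ) (hD : D ≠ 0) (r : 𝓞 F)
    (I J P : Ideal (𝓞 F)) (hI : (D : 𝓞 F) ∈ I) (hPJ : P ∣ J)
    (hJ : (J : FractionalIdeal (𝓞 F)⁰ F) =
      FractionalIdeal.spanSingleton (𝓞 F)⁰ (((n : F) + (δ : F) * (r : F)) / (2 * (D : F))) *
        (I : FractionalIdeal (𝓞 F)⁰ F)) : ∃ z ∈ P, 2 * z = n + δ * r := by
  have hDF : (D : F) ≠ 0 := by exact_mod_cast hD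
  have h1 : ((n : F) + (δ : F) * (r : F)) / 2 ∈ (J : FractionalIdeal (𝓞 F)⁰ F) := by
    rw [hJ]
    have : ((n : F) + (δ : F) * (r : F)) / 2 =
        (((n : F) + (δ : F) * (r : F)) / (2 * (D : F))) * algebraMap (𝓞 F) F (D : 𝓞 F) := by
      rw [map_intCast]; field_simp
    rw [this]
    exact FractionalIdeal.mul_mem_mul (FractionalIdeal.mem_spanSingleton_self _ _)
      (FractionalIdeal.mem_coeIdeal_of_mem _ hI)
  obtain ⟨z, hz, hzr⟩ := (FractionalIdeal.mem_coeIdeal _).mp h1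
  refine ⟨z, (Ideal.dvd_iff_le.mp hPJ) hz, RingOfIntegers.coe_injective ?_⟩
  simp only [map_mul, map_add, map_ofNat, map_intCast, hzr]
  simp only [RingOfIntegers.coe_eq_algebraMap]
  ring

theorem even_template {F K : Type*} [Field F] [NumberField F] [Field K] [NumberField K] [Algebra F K]
    (P : Ideal (𝓞 F)) [P.IsMaximal] (hP0 : P ≠ ⊥) (h2 : Module.finrank F K = 2)
    (hpP : (2 : 𝓞 F) ∈ P) (hres : ∀ y : 𝓞 F, ∃ h : ℤ, y - h ∈ P)
    (t : 𝓞 K) (ht : ∀ c : F, algebraMap F K c ≠ (t : K)) (D n N1 c0 c1 j q : ℤ) (z : 𝓞 F)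
    (hz : z ∈ P) (hzy : z * (n - z) = -(D * (2 * N1))) (hn : n % 2 = 1)
    (hβ : t ^ 2 = algebraMap (𝓞 F) (𝓞 K) (c0 + c1 * z)) (hj : c0 - 1 = 2 * j)
    (hq : 2 * q = j * n - c1 * D * N1) (S I : Prop)
    (hS : S ↔ (q * n + j * D * N1) % 2 = 0) (hI : I ↔ (q * n + j * D * N1) % 2 = 1) :
    SplitConcl K P S I := by
  have hy0 : (n : 𝓞 F) - z ∉ P := by
    intro h
    have h1 := P.add_mem h hz
    rw [sub_add_cancel, int_mem_iff P 2 Nat.prime_two (by simpa using hpP)] at h1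
    push_cast at h1
    omega
  have hyne : algebraMap (𝓞 F) F ((n : 𝓞 F) - z) ≠ 0 := by
    rw [Ne, FaithfulSMul.algebraMap_eq_zero_iff]
    intro h; exact hy0 (h ▸ P.zero_mem)
  have hjF : (c0 : 𝓞 F) - 1 = 2 * j := by exact_mod_cast congrArg (Int.cast : ℤ → 𝓞 F) hj
  have hqF : 2 * (q : 𝓞 F) = j * n - c1 * D * N1 := by
    exact_mod_cast congrArg (Int.cast : ℤ → 𝓞 F) hq
  apply even_core P hP0 h2 hpP hres (t * algebraMap (𝓞 F) (𝓞 K) (n - z)) (a := n - z)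
    (g := q * (n - z) + j * D * N1) (a0 := n) (g0 := q * n + j * D * N1) (hS := hS) (hI := hI)
    (ha0 := hn)
  · intro c hc
    apply ht (c / algebraMap (𝓞 F) F (n - z))
    have hy' : algebraMap F K (algebraMap (𝓞 F) F ((n : 𝓞 F) - z)) ≠ 0 := (map_ne_zero _).mpr hyne
    rw [map_div₀, hc, div_eq_iff hy']
    rw [← IsScalarTower.algebraMap_apply, IsScalarTower.algebraMap_apply (𝓞 F) (𝓞 K) K]
    simp only [RingOfIntegers.coe_eq_algebraMap]
    rw [map_mul]
  · rw [mul_pow, hβ, ← map_pow, ← map_mul]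
    congr 1
    linear_combination (((n : 𝓞 F) - z) * c1 - 2 * j) * hzy + ((n : 𝓞 F) - z) ^ 2 * hjF 
      - 2 * ((n : 𝓞 F) - z) * hqF
  · have : (n : 𝓞 F) - z - n = - z := by ring
    rw [this]; exact P.neg_mem hz
  · have : (q : 𝓞 F) * (n - z) + j * D * N1 - ((q * n + j * D * N1 : ℤ) : 𝓞 F) = - (q * z) := by
      push_cast; ring
    rw [this]; exact P.neg_mem (P.mul_mem_left _ hz)

theorem main_id1 (D A2 B2 Dt δ n N m : ℤ) (hD : D ≠ 0) (hDt : 4 * Dt = A2 ^ 2 - B2 ^ 2 * D)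
    (hNN : 4 * D * N = δ ^ 2 * Dt - n ^ 2) (hm : D * m = 2 * n + δ * A2) :
    16 * N = -δ ^ 2 * B2 ^ 2 - D * m ^ 2 + 2 * m * δ * A2 := by
  apply mul_left_cancel₀ hD
  linear_combination 4 * hNN + δ ^ 2 * hDt + (D * m - δ * A2 + 2 * n) * hm

theorem main_id2 (D A2 B2 δ N m s e : ℤ)
    (h : 16 * N = -δ ^ 2 * B2 ^ 2 - D * m ^ 2 + 2 * m * δ * A2)
    (hs : D - 4 * δ = s ^ 2) (he : 2 * e = A2 - B2 * s) :
    16 * N = 4 * (δ * m) * (e - m) - (δ * B2 - s * m) ^ 2 := by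
  linear_combination h - m ^ 2 * hs - 2 * m * δ * he

theorem leg_congr (p : ℕ) [Fact p.Prime] (a b : ℤ) (h : (p : ℤ) ∣ a - b) :
    legendreSym p a = legendreSym p b := by
  rw [legendreSym.mod p a, legendreSym.mod p b,
    Int.emod_eq_emod_iff_emod_sub_eq_zero.mpr (Int.emod_eq_zero_of_dvd h)]

theorem leg_case (p : ℕ) [hp : Fact p.Prime] (hp2 : p ≠ 2) (du dx t g : ℤ)
    (h : (p : ℤ) ∣ 4 * du * dx - t ^ 2) (hdu : ¬ (p : ℤ) ∣ du)
    (hg : legendreSym p g = legendreSym p du) :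
    ((legendreSym p dx = 1 ∨ legendreSym p du = 1) ↔ legendreSym p g = 1) ∧
    ((legendreSym p dx = -1 ∨ legendreSym p du = -1) ↔ legendreSym p g = -1) := by
  have h4 : ¬ (p : ℤ) ∣ 4 := by
    intro h5
    have h6 : p ∣ 2 ^ 2 := by exact_mod_cast h5
    have := hp.out.dvd_of_dvd_pow h6
    exact hp2 ((Nat.prime_dvd_prime_iff_eq hp.out Nat.prime_two).mp this)
  have h2 : ¬ (p : ℤ) ∣ 2 := fun h => h4 (h.trans ⟨2, by norm_num⟩)
  have hpi : Prime (p : ℤ) := Nat.prime_iff_prime_int.mp hp.out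
  by_cases ht : (p : ℤ) ∣ t
  · have h5 : (p : ℤ) ∣ 4 * du * dx := by
      have := dvd_add h (ht.trans ⟨t, by ring⟩ : (p : ℤ) ∣ t ^ 2)
      simpa using this
    have hdx : (p : ℤ) ∣ dx := by
      rcases hpi.dvd_or_dvd h5 with h6 | h6
      · rcases hpi.dvd_or_dvd h6 with h7 | h7
        · exact absurd h7 h4
        · exact absurd h7 hdu
      · exact h6
    have : legendreSym p dx = 0 := by
      rw [legendreSym.eq_zero_iff, ZMod.intCast_zmod_eq_zero_iff_dvd]; exact hdx
    rw [this, hg]; norm_num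
  · have e1 := leg_congr p _ _ h
    have e2 : legendreSym p (t ^ 2) = 1 := by
      apply legendreSym.sq_one'
      rwa [Ne, ZMod.intCast_zmod_eq_zero_iff_dvd]
    have e3 : legendreSym p 4 = 1 := by
      rw [show (4 : ℤ) = 2 ^ 2 by norm_num]
      apply legendreSym.sq_one'
      rwa [Ne, ZMod.intCast_zmod_eq_zero_iff_dvd]
    rw [e2, legendreSym.mul, legendreSym.mul, e3, one_mul] at e1
    have hdu0 : ((du : ℤ) : ZMod p) ≠ 0 := by rwa [Ne, ZMod.intCast_zmod_eq_zero_iff_dvd]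
    rcases legendreSym.eq_one_or_neg_one p hdu0 with h | h <;> rw [h] at e1 hg ⊢ <;> rw [hg]
    · norm_num at e1 ⊢
      rw [e1]; norm_num
    · have : legendreSym p dx = -1 := by linarith
      rw [this]; norm_num

theorem leg_sq_mul (p : ℕ) [hp : Fact p.Prime] (c a : ℤ) (hc : ¬ (p : ℤ) ∣ c) :
    legendreSym p (c ^ 2 * a) = legendreSym p a := by
  rw [legendreSym.mul, legendreSym.sq_one' p, one_mul]
  rwa [Ne, ZMod.intCast_zmod_eq_zero_iff_dvd]

theorem fund_odd (d : ℤ) (hd : IsFundamentalDiscriminant d) (p : ℕ) (hp : p.Prime) (hp2 : p ≠ 2)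
    (h : (p : ℤ) * p ∣ d) : False := by
  have hpi : Prime (p : ℤ) := Nat.prime_iff_prime_int.mp hp
  rcases hd with ⟨-, hsf⟩ | ⟨m, rfl, hsf, -⟩
  · exact hpi.not_isUnit (hsf _ h)
  · apply hpi.not_isUnit (hsf _ _)
    have hc : IsCoprime ((p : ℤ) * p) 4 := by
      rw [← pow_two, show (4 : ℤ) = 2 ^ 2 by norm_num]
      apply IsCoprime.pow
      rw [Prime.coprime_iff_not_dvd hpi]
      intro h5
      have h6 : p ∣ 2 := by exact_mod_cast h5
      exact hp2 ((Nat.prime_dvd_prime_iff_eq hp Nat.prime_two).mp h6)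
    exact hc.dvd_of_dvd_mul_left h
theorem leg_zero (p : ℕ) [Fact p.Prime] (a : ℤ) (h : (p : ℤ) ∣ a) : legendreSym p a = 0 := by
  rw [legendreSym.eq_zero_iff, ZMod.intCast_zmod_eq_zero_iff_dvd]; exact h

theorem odd_case {F K : Type*} [Field F] [NumberField F] [Field K] [NumberField K] [Algebra F K]
    (D A2 B2 Dt δ s n N m e : ℤ) (hDp : Prime D) (hDpos : 0 < D)
    (hDt : 4 * Dt = A2 ^ 2 - B2 ^ 2 * D) (hsf : Squarefree Dt) (hδ : 0 < δ)
    (hs : D - 4 * δ = s ^ 2) (hNN : 4 * D * N = δ ^ 2 * Dt - n ^ 2)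
    (hm : D * m = 2 * n + δ * A2) (he : 2 * e = A2 - B2 * s)
    (hfund : IsFundamentalDiscriminant (δ * m))
    (hrF : Module.finrank ℚ F = 2) (hrK : Module.finrank F K = 2)
    (r : 𝓞 F) (hr : r ^ 2 = (Dt : 𝓞 F)) (hrn : ∀ c : ℚ, algebraMap ℚ F c ≠ (r : F))
    (ω : 𝓞 F) (hω : 2 * ω = 1 + r)
    (hT1 : ∀ (β : 𝓞 F) (k c : ℤ), k ≠ 0 → c ≠ 0 → (c : 𝓞 F) ^ 2 * β = k ^ 2 * (A2 + 2 * r) →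
      ∃ t : 𝓞 K, t ^ 2 = algebraMap (𝓞 F) (𝓞 K) β ∧ ∀ c : F, algebraMap F K c ≠ (t : K))
    (hT2 : ∀ (β : 𝓞 F) (k c : ℤ), k ≠ 0 → c ≠ 0 → (c : 𝓞 F) ^ 2 * β = k ^ 2 * (D * (A2 - 2 * r)) →
      ∃ t : 𝓞 K, t ^ 2 = algebraMap (𝓞 F) (𝓞 K) β ∧ ∀ c : F, algebraMap F K c ≠ (t : K))
    (P : Ideal (𝓞 F)) [P.IsMaximal] (hP0 : P ≠ ⊥)
    (p : ℕ) [hp : Fact p.Prime] (hp2 : p ≠ 2) (hpP : (p : 𝓞 F) ∈ P) (hpN : (p : ℤ) ∣ N)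
    (z : 𝓞 F) (hz : z ∈ P) (hzr : 2 * z = n + δ * r) :
    SplitConcl K P (legendreSym p (e - m) = 1 ∨ legendreSym p (δ * m) = 1)
      (legendreSym p (e - m) = -1 ∨ legendreSym p (δ * m) = -1) := by
  have hpi : Prime (p : ℤ) := Nat.prime_iff_prime_int.mp hp.out
  have hmem := int_mem_iff P p hp.out hpP
  have hp2' : ¬ (p : ℤ) ∣ 2 := by
    intro h5
    have h6 : p ∣ 2 := by exact_mod_cast h5
    exact hp2 ((Nat.prime_dvd_prime_iff_eq hp.out Nat.prime_two).mp h6)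
  have hp4' : ¬ (p : ℤ) ∣ 4 := by
    intro h
    rw [show (4 : ℤ) = 2 * 2 by norm_num] at h
    rcases hpi.dvd_or_dvd h with h | h <;> exact hp2' h
  have hpD : (p : ℤ) ∣ D → (p : ℤ) = D := by
    intro h
    have h1 := (hpi.associated_of_dvd hDp h)
    rcases Int.associated_iff.mp h1 with h2 | h2
    · exact h2
    · have := hp.out.pos; omega
  have hD4 : 4 * δ ≤ D := by nlinarith [sq_nonneg s]
  have id1 := main_id1 D A2 B2 Dt δ n N m hDpos.ne' hDt hNN hm
  have id2 := main_id2 D A2 B2 δ N m s e id1 hs he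
  have hpδ : ¬ (p : ℤ) ∣ δ := by
    intro h
    have hn2 : (p : ℤ) ∣ n ^ 2 := by
      have : n ^ 2 = δ * (δ * Dt) - N * (4 * D) := by linear_combination hNN
      rw [this]
      exact dvd_sub (h.mul_right _) (hpN.mul_right _)
    have hn := hpi.dvd_of_dvd_pow hn2
    have h1 : (p : ℤ) ∣ D * m := by
      rw [hm]; exact dvd_add (hn.mul_left _) (h.mul_right _)
    rcases hpi.dvd_or_dvd h1 with h2 | h2
    · have h3 := hpD h2
      have := Int.le_of_dvd hδ h
      omega
    · exact fund_odd _ hfund p hp.out hp2 (mul_dvd_mul h h2)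
  have hres : ∀ y : 𝓞 F, ∃ h : ℤ, y - h ∈ P := by
    intro y
    obtain ⟨u, v, rfl⟩ := int_basis' hrF Dt hsf r hr hrn ω hω y
    have hnd : ¬ (p : ℤ) ∣ 2 * δ := fun h => (hpi.dvd_or_dvd h).elim hp2' hpδ
    obtain ⟨a, k, hk⟩ := (Prime.coprime_iff_not_dvd hpi).mpr hnd
    have hkF : (a : 𝓞 F) * p + k * (2 * δ) = 1 := by
      exact_mod_cast congrArg (Int.cast : ℤ → 𝓞 F) hk
    refine ⟨u + v * (k * (δ - n)), ?_⟩
    have : (u : 𝓞 F) + v * ω - ((u + v * (k * (δ - n)) : ℤ) : 𝓞 F) =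
        v * k * 2 * z + v * a * ω * p := by
      push_cast
      linear_combination (-(v : 𝓞 F) * ω) * hkF - v * k * hzr + v * k * δ * hω
    rw [this]
    exact P.add_mem (P.mul_mem_left _ hz) (P.mul_mem_left _ hpP)
  have hmF : (D : 𝓞 F) * m = 2 * n + δ * A2 := by
    exact_mod_cast congrArg (Int.cast : ℤ → 𝓞 F) hm
  have hδ2 : ¬ (p : ℤ) ∣ δ ^ 2 := fun h => hpδ (hpi.dvd_of_dvd_pow h)
  -- the first type of generator
  have hβ1 : ∀ hDm : (p : ℤ) ∣ D * m, ((δ ^ 2 * (A2 + 2 * r) : 𝓞 F) - ((δ ^ 2 * (2 * A2) : ℤ) : 𝓞 F)) ∈ P := by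
    intro hDm
    have e1 : (δ ^ 2 * (A2 + 2 * r) : 𝓞 F) - ((δ ^ 2 * (2 * A2) : ℤ) : 𝓞 F) =
        δ * 4 * z - δ * ((D * m : ℤ) : 𝓞 F) := by
      push_cast
      linear_combination (-2 * (δ : 𝓞 F)) * hzr + δ * hmF
    rw [e1]
    exact P.sub_mem (P.mul_mem_left _ hz) (P.mul_mem_left _ ((hmem _).mpr hDm))
  by_cases hpm : (p : ℤ) ∣ m
  · have hB : (p : ℤ) ∣ B2 := by
      have h1 : (p : ℤ) ∣ (δ * B2 - s * m) ^ 2 := by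
        have : (δ * B2 - s * m) ^ 2 = m * (4 * δ * (e - m)) - N * 16 := by linear_combination id2
        rw [this]
        exact dvd_sub (hpm.mul_right _) (hpN.mul_right _)
      have h2 : (p : ℤ) ∣ δ * B2 := by
        have := dvd_add (hpi.dvd_of_dvd_pow h1) (hpm.mul_left s)
        simpa using this
      exact (hpi.dvd_or_dvd h2).resolve_left hpδ
    have hA : ¬ (p : ℤ) ∣ A2 := by
      rintro ⟨a, ha⟩
      obtain ⟨b, hb⟩ := hB
      have h1 : (p : ℤ) * p ∣ 4 * Dt := ⟨a ^ 2 - b ^ 2 * D, by rw [hDt, ha, hb]; ring⟩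
      apply hpi.not_isUnit (hsf _ _)
      have hc : IsCoprime ((p : ℤ) * p) 4 := by
        have := (Prime.coprime_iff_not_dvd hpi).mpr hp4'
        exact this.mul_left this
      exact hc.dvd_of_dvd_mul_left h1
    obtain ⟨t, ht, htn⟩ := hT1 (δ ^ 2 * (A2 + 2 * r)) δ 1 hδ.ne' one_ne_zero (by push_cast; ring)
    have hgleg : legendreSym p (δ ^ 2 * (2 * A2)) = legendreSym p (e - m) := by
      rw [leg_sq_mul p _ _ hpδ, ← leg_sq_mul p 2 (e - m) hp2']
      apply leg_congr
      have : 2 * A2 - 2 ^ 2 * (e - m) = B2 * (2 * s) + m * 4 := by linear_combination -2 * he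
      rw [this]
      exact dvd_add (hB.mul_right _) (hpm.mul_right _)
    apply odd_core P hP0 hrK p hp2 hpP hres t htn _ ht (δ ^ 2 * (2 * A2)) (hβ1 (hpm.mul_left _))
    · intro h
      rcases hpi.dvd_or_dvd h with h | h
      · exact hδ2 h
      · exact (hpi.dvd_or_dvd h).elim hp2' hA
    · rw [hgleg, leg_zero p (δ * m) (hpm.mul_left _)]; norm_num
    · rw [hgleg, leg_zero p (δ * m) (hpm.mul_left _)]; norm_num
  · have hdu : ¬ (p : ℤ) ∣ δ * m := fun h => (hpi.dvd_or_dvd h).elim hpδ hpm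
    have hdd : (p : ℤ) ∣ 4 * (δ * m) * (e - m) - (δ * B2 - s * m) ^ 2 := by
      rw [← id2]; exact hpN.mul_left _
    by_cases hpD' : (p : ℤ) ∣ D
    · have hA : ¬ (p : ℤ) ∣ A2 := by
        intro hA
        have h1 : (p : ℤ) ∣ (δ * B2) ^ 2 := by
          have : (δ * B2) ^ 2 = A2 * (2 * m * δ) - D * m ^ 2 - N * 16 := by linear_combination id1
          rw [this]
          exact dvd_sub (dvd_sub (hA.mul_right _) (hpD'.mul_right _)) (hpN.mul_right _)
        have hB := (hpi.dvd_or_dvd (hpi.dvd_of_dvd_pow h1)).resolve_left hpδ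
        obtain ⟨a, ha⟩ := hA
        obtain ⟨b, hb⟩ := hB
        have h1 : (p : ℤ) * p ∣ 4 * Dt := ⟨a ^ 2 - b ^ 2 * D, by rw [hDt, ha, hb]; ring⟩
        apply hpi.not_isUnit (hsf _ _)
        have hc : IsCoprime ((p : ℤ) * p) 4 := by
          have := (Prime.coprime_iff_not_dvd hpi).mpr hp4'
          exact this.mul_left this
        exact hc.dvd_of_dvd_mul_left h1
      have h2A : ¬ (p : ℤ) ∣ 2 * A2 := fun h => (hpi.dvd_or_dvd h).elim hp2' hA
      have hcong : (p : ℤ) ∣ (2 * A2) * (δ * m) - (δ * B2) ^ 2 := by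
        have : (2 * A2) * (δ * m) - (δ * B2) ^ 2 = D * m ^ 2 + N * 16 := by linear_combination -id1
        rw [this]
        exact dvd_add (hpD'.mul_right _) (hpN.mul_right _)
      have hB : ¬ (p : ℤ) ∣ δ * B2 := by
        intro h
        have h3 := dvd_add hcong (h.mul_right (δ * B2))
        rw [show (2 * A2) * (δ * m) - (δ * B2) ^ 2 + δ * B2 * (δ * B2) = (2 * A2) * (δ * m) by ring] at h3
        exact (hpi.dvd_or_dvd h3).elim h2A hdu
      have e1 := leg_congr p _ _ hcong
      rw [legendreSym.sq_one' p (by rwa [Ne, ZMod.intCast_zmod_eq_zero_iff_dvd]), legendreSym.mul] at e1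
      have hgleg : legendreSym p (δ ^ 2 * (2 * A2)) = legendreSym p (δ * m) := by
        rw [leg_sq_mul p _ _ hpδ]
        have hdu0 : ((δ * m : ℤ) : ZMod p) ≠ 0 := by rwa [Ne, ZMod.intCast_zmod_eq_zero_iff_dvd]
        rcases legendreSym.eq_one_or_neg_one p hdu0 with h | h <;> rw [h] at e1 ⊢ <;> linarith
      obtain ⟨t, ht, htn⟩ := hT1 (δ ^ 2 * (A2 + 2 * r)) δ 1 hδ.ne' one_ne_zero (by push_cast; ring)
      have hlc := leg_case p hp2 (δ * m) (e - m) (δ * B2 - s * m) _ hdd hdu hgleg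
      apply odd_core P hP0 hrK p hp2 hpP hres t htn _ ht (δ ^ 2 * (2 * A2)) (hβ1 (hpD'.mul_right _))
      · intro h
        rcases hpi.dvd_or_dvd h with h | h
        · exact hδ2 h
        · exact h2A h
      · exact hlc.1
      · exact hlc.2
    · have hgleg : legendreSym p (D ^ 2 * (δ * m)) = legendreSym p (δ * m) :=
        leg_sq_mul p _ _ hpD'
      obtain ⟨t, ht, htn⟩ := hT2 (δ ^ 2 * (D * (A2 - 2 * r))) δ 1 hδ.ne' one_ne_zero (by push_cast; ring)
      have hlc := leg_case p hp2 (δ * m) (e - m) (δ * B2 - s * m) _ hdd hdu hgleg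
      apply odd_core P hP0 hrK p hp2 hpP hres t htn _ ht (D ^ 2 * (δ * m))
      · have e1 : (δ ^ 2 * (D * (A2 - 2 * r)) : 𝓞 F) - ((D ^ 2 * (δ * m) : ℤ) : 𝓞 F) =
            -(4 * D * δ) * z := by
          push_cast
          linear_combination (2 * (δ : 𝓞 F) * D) * hzr - D * δ * hmF
        rw [e1]
        exact P.mul_mem_left _ hz
      · intro h
        rcases hpi.dvd_or_dvd h with h | h
        · exact hpD' (hpi.dvd_of_dvd_pow h)
        · exact hdu h
      · exact hlc.1
      · exact hlc.2

theorem odd_sq8 (x : ℤ) (h : x % 2 = 1) : x ^ 2 % 8 = 1 := by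
  obtain ⟨y, rfl⟩ : ∃ y, x = 2 * y + 1 := ⟨x / 2, by omega⟩
  obtain ⟨v, hv⟩ := Int.even_mul_succ_self y
  have : (2 * y + 1) ^ 2 = 1 + 8 * v := by linear_combination 4 * hv
  omega

theorem ie1 (du dx t N1 k : ℤ) (h : 32 * N1 = 4 * du * dx - t ^ 2) (hk : du = 1 + 4 * k) :
    ((dx % 8 = 1 ∨ du % 8 = 1) ↔ k % 2 = 0) ∧ ((dx % 8 = 5 ∨ du % 8 = 5) ↔ k % 2 = 1) := by
  have ht : t % 2 = 0 := by
    rcases Int.emod_two_eq_zero_or_one t with h1 | h1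
    · exact h1
    · have := odd_sq8 t h1
      rw [mul_assoc] at h
      omega
  obtain ⟨t1, rfl⟩ : ∃ t1, t = 2 * t1 := ⟨t / 2, by omega⟩
  have h' : 8 * N1 = dx + 4 * (k * dx) - t1 ^ 2 := by subst hk; linarith
  rcases Int.emod_two_eq_zero_or_one t1 with h1 | h1
  · obtain ⟨t2, rfl⟩ : ∃ t2, t1 = 2 * t2 := ⟨t1 / 2, by omega⟩
    have : (2 * t2) ^ 2 = 4 * t2 ^ 2 := by ring
    rw [this] at h'
    omega
  · have h2 := odd_sq8 t1 h1
    obtain ⟨x, rfl⟩ : ∃ x, dx = 2 * x + 1 := ⟨dx / 2, by omega⟩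
    have : k * (2 * x + 1) = 2 * (k * x) + k := by ring
    rw [this] at h'
    omega

theorem ie2a (D δ k i n A dx N1 l u b s j q : ℤ) (hD : D % 8 = 5) (hδ : δ % 2 = 1)
    (hk : k % 2 = 1) (hi : δ * k = 3 + 4 * i) (hn : n = 2 * D * k - δ * A)
    (hdx : dx = A - 4 * (b * s) - 4 * k)
    (hN : 2 * N1 = δ * k * dx - u ^ 2) (hu : u % 2 = 1) (hl : N1 = 1 + 2 * l)
    (hj : D ^ 2 * (δ * k) - 1 = 2 * j) (hq : 2 * q = j * n + D * δ * D * N1) :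
    (dx % 8 = 1 ↔ (q * n + j * D * N1) % 2 = 0) ∧ (dx % 8 = 5 ↔ (q * n + j * D * N1) % 2 = 1) := by
  have hu8 := odd_sq8 u hu
  have hD8 := odd_sq8 D (by omega)
  obtain ⟨d2, hd2⟩ : ∃ x, D ^ 2 = 1 + 8 * x := ⟨D ^ 2 / 8, by omega⟩
  rw [hi] at hN hj
  have hdx1 : dx % 2 = 1 := by
    have : (3 + 4 * i) * dx = 3 * dx + 2 * (2 * i * dx) := by ring
    rw [this] at hN
    omega
  obtain ⟨x, hx⟩ : ∃ x, dx = 2 * x + 1 := ⟨dx / 2, by omega⟩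
  have hdx8 : (dx - (1 + 4 * (i + l))) % 8 = 0 := by
    have : (3 + 4 * i) * dx = 3 * dx + 4 * i + 8 * (i * x) := by rw [hx]; ring
    rw [this] at hN
    omega
  have hj4 : (j - (1 + 2 * i)) % 4 = 0 := by
    have : (1 + 8 * d2) * (3 + 4 * i) = 3 + 4 * i + 8 * (d2 * (3 + 4 * i)) := by ring
    rw [hd2, this] at hj
    omega
  have hA4 : A % 4 = 1 := by omega
  obtain ⟨a, ha⟩ : ∃ a, A = 1 + 4 * a := ⟨A / 4, by omega⟩
  obtain ⟨D', hD'⟩ : ∃ x, D = 1 + 4 * x := ⟨D / 4, by omega⟩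
  obtain ⟨d, hd⟩ : ∃ x, δ = 1 + 2 * x := ⟨δ / 2, by omega⟩
  obtain ⟨k', hk'⟩ : ∃ x, k = 1 + 2 * x := ⟨k / 2, by omega⟩
  obtain ⟨j', hj'⟩ : ∃ x, j = 1 + 2 * i + 4 * x := ⟨(j - (1 + 2 * i)) / 4, by omega⟩
  obtain ⟨n', hn'⟩ : ∃ x, n = δ + 4 * x := by
    refine ⟨(2 * D * k - δ * A - δ) / 4, ?_⟩
    have : 2 * D * k - δ * A - δ = 4 * (2 * D' * k + k' - δ * a - d) := by
      rw [ha, hD', hk', hd]; ring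
    rw [this]
    omega
  have hq2 : (q - (1 + i + l)) % 2 = 0 := by
    have e : 2 * q = 2 * (1 + i + l) + 4 * (d * (1 + i + l) + j * n' + j' * δ + 2 * d2 * δ * N1) := by
      rw [hq, show D * δ * D * N1 = D ^ 2 * (δ * N1) by ring, hd2, hn']
      rw [show j * (δ + 4 * n') = j * δ + 4 * (j * n') by ring, hl]
      nth_rewrite 1 [hj']
      rw [hd]; ring
    omega
  have hpar : (q * n + j * D * N1 - (i + l)) % 2 = 0 := by
    obtain ⟨y, hy⟩ : ∃ y, q = 1 + i + l + 2 * y := ⟨(q - (1 + i + l)) / 2, by omega⟩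
    have e : q * n + j * D * N1 - (i + l) = 2 * (y + q * (d + 2 * n') + 1 + 
       (i + 2 * j') * D * N1 + 2 * D' * N1 + l) := by
      rw [hn', hd, hj', hD', hl, hy]; ring
    rw [e]; omega
  omega

theorem ie2b (D δ k' n A A' dx N1 u b s j q : ℤ) (hD : D % 8 = 5) (hδ : δ % 2 = 1)
    (hk : k' % 2 = 1) (hs : s % 2 = 1) (hn : n = 4 * D * k' - δ * A) (hA : A = 1 + 4 * A')
    (hdx : dx = A - 4 * (b * s) - 8 * k') (hu : u = δ * b - s * k')
    (hN : N1 = δ * k' * dx - 2 * u ^ 2)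
    (hj : δ ^ 2 * A - δ * D * (2 * k') - 1 = 2 * j) (hq : 2 * q = j * n - δ * D * N1) :
    (dx % 8 = 1 ↔ (q * n + j * D * N1) % 2 = 0) ∧ (dx % 8 = 5 ↔ (q * n + j * D * N1) % 2 = 1) := by
  have hδ8 := odd_sq8 δ hδ
  obtain ⟨d2, hd2⟩ : ∃ x, δ ^ 2 = 1 + 8 * x := ⟨δ ^ 2 / 8, by omega⟩
  obtain ⟨D', hD'⟩ : ∃ x, D = 1 + 4 * x := ⟨D / 4, by omega⟩
  obtain ⟨d, hd⟩ : ∃ x, δ = 1 + 2 * x := ⟨δ / 2, by omega⟩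
  obtain ⟨kk, hkk⟩ : ∃ x, k' = 1 + 2 * x := ⟨k' / 2, by omega⟩
  obtain ⟨ss, hss⟩ : ∃ x, s = 1 + 2 * x := ⟨s / 2, by omega⟩
  have hdx8 : (dx - (1 + 4 * (A' + b))) % 8 = 0 := by
    have : b * s = b + 2 * (b * ss) := by rw [hss]; ring
    rw [this] at hdx
    omega
  have hj' : j = 2 * A' - δ * k' + 4 * (d2 * A - δ * k' * D') := by
    have e : δ ^ 2 * A - δ * D * (2 * k') - 1 = 2 * (2 * A' - δ * k' + 4 * (d2 * A - δ * k' * D')) := by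
      rw [hd2, hD', hA]; ring
    omega
  have hn' : n = -δ + 4 * (D * k' - δ * A') := by rw [hn, hA]; ring
  have hu' : (u - (b + 1)) % 2 = 0 := by
    have : u - (b + 1) = 2 * (d * b - kk - ss * k' - 1) := by rw [hu, hd, hss, hkk]; ring
    omega
  obtain ⟨v, hv⟩ : ∃ v, u ^ 2 = u + 2 * v := by
    obtain ⟨v, hv⟩ := Int.even_mul_pred_self u
    exact ⟨v, by linear_combination hv⟩
  obtain ⟨X, hX⟩ : ∃ X, dx = 1 + 4 * X := ⟨A' - b * s - 2 * k', by rw [hdx, hA]; ring⟩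
  have hN' : N1 = δ * k' - 2 * u + 4 * (δ * k' * X - v) := by rw [hN, hv, hX]; ring
  have hq2 : (q - (u - A')) % 2 = 0 := by
    have e : 2 * q = 2 * (u - A') + 4 * (d * (u - A') + j * (D * k' - δ * A') - 
       δ * (d2 * A - δ * k' * D') - δ * D' * N1 - δ * (δ * k' * X - v)) := by
      have e1 : j * n = -δ * (2 * A' - δ * k' + 4 * (d2 * A - δ * k' * D')) + 4 * (j * (D * k' - δ * A')) := by
        rw [← hj']; nth_rewrite 1 [hn']; ring
      have e2 : δ * D * N1 = δ * (δ * k' - 2 * u + 4 * (δ * k' * X - v)) + 4 * (δ * D' * N1) := by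
        rw [← hN']; nth_rewrite 1 [hD']; ring
      have e3 : 2 * (u - A') + 4 * (d * (u - A')) = 2 * δ * (u - A') := by rw [hd]; ring
      rw [hq, e1, e2]; linear_combination -e3
    omega
  have hj1 : j % 2 = 1 := by
    have : δ * k' = 1 + 2 * (d + kk + 2 * d * kk) := by rw [hd, hkk]; ring
    rw [this] at hj'
    omega
  have hN1 : N1 % 2 = 1 := by
    have : δ * k' = 1 + 2 * (d + kk + 2 * d * kk) := by rw [hd, hkk]; ring
    rw [this] at hN'
    omega
  have hn1 : n % 2 = 1 := by omega
  have p1 : (q * n) % 2 = q % 2 := by rw [Int.mul_emod, hn1]; omega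
  have p2 : (j * D * N1) % 2 = 1 := by
    rw [Int.mul_emod, Int.mul_emod j, hj1, hN1, show D % 2 = 1 by omega]; norm_num
  omega

theorem par_n (D Dt δ n N : ℤ) (hDt4 : Dt % 4 = 1) (hNN : 4 * D * N = δ ^ 2 * Dt - n ^ 2)
    (hδ : δ % 2 = 1) : n % 2 = 1 := by
  have h1 := odd_sq8 δ hδ
  rcases Int.emod_two_eq_zero_or_one n with h | h
  · exfalso
    obtain ⟨y, rfl⟩ : ∃ y, n = 2 * y := ⟨n / 2, by omega⟩
    have e2 : (2 * y) ^ 2 = 4 * y ^ 2 := by ring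
    obtain ⟨x, hx⟩ : ∃ x, δ ^ 2 = 1 + 8 * x := ⟨δ ^ 2 / 8, by omega⟩
    have e : (1 + 8 * x) * Dt = Dt + 8 * (x * Dt) := by ring
    rw [hx, e2, e, mul_assoc] at hNN
    omega
  · exact h

theorem four_mem {F : Type*} [Field F] [NumberField F] (P : Ideal (𝓞 F)) (h2 : (2 : 𝓞 F) ∈ P) :
    (4 : 𝓞 F) ∈ P ^ 2 := by
  rw [show (4 : 𝓞 F) = 2 * 2 by norm_num, pow_two]
  exact Ideal.mul_mem_mul h2 h2

theorem int_mem_sq {F : Type*} [Field F] [NumberField F] (P : Ideal (𝓞 F)) (h2 : (2 : 𝓞 F) ∈ P)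
    (k : ℤ) (hk : k % 4 = 0) : (k : 𝓞 F) ∈ P ^ 2 := by
  obtain ⟨l, rfl⟩ : ∃ l, k = 4 * l := ⟨k / 4, by omega⟩
  push_cast
  exact Ideal.mul_mem_right _ _ (four_mem P h2)

theorem mem_sq_of_mul {F : Type*} [Field F] [NumberField F] (P : Ideal (𝓞 F)) [P.IsMaximal]
    (a b : 𝓞 F) (ha : a ∉ P) (h : a * b ∈ P ^ 2) : b ∈ P ^ 2 :=
  (Ideal.IsPrime.mul_mem_pow P h).resolve_left ha

theorem res_even {F : Type*} [Field F] [NumberField F] (Dt δ n : ℤ) (hsf : Squarefree Dt)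
    (hrF : Module.finrank ℚ F = 2)
    (r : 𝓞 F) (hr : r ^ 2 = (Dt : 𝓞 F)) (hrn : ∀ c : ℚ, algebraMap ℚ F c ≠ (r : F))
    (ω : 𝓞 F) (hω : 2 * ω = 1 + r) (P : Ideal (𝓞 F)) (h2P : (2 : 𝓞 F) ∈ P)
    (z : 𝓞 F) (hz : z ∈ P) (hzr : 2 * z = n + δ * r) (hδ : δ % 2 = 1) (hn : n % 2 = 1) :
    ∀ y : 𝓞 F, ∃ h : ℤ, y - h ∈ P := by
  intro y
  obtain ⟨u, v, rfl⟩ := int_basis' hrF Dt hsf r hr hrn ω hω y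
  obtain ⟨d, rfl⟩ : ∃ x, δ = 1 + 2 * x := ⟨δ / 2, by omega⟩
  obtain ⟨c, rfl⟩ : ∃ x, n = 1 + 2 * d + 2 * x := ⟨(n - (1 + 2 * d)) / 2, by omega⟩
  push_cast at hzr
  have hz' : z = (1 + 2 * d) * ω + c := by
    apply mul_left_cancel₀ (two_ne_zero : (2 : 𝓞 F) ≠ 0)
    linear_combination hzr - (1 + 2 * d : 𝓞 F) * hω
  refine ⟨u - v * c, ?_⟩
  have e : (u : 𝓞 F) + v * ω - ((u - v * c : ℤ) : 𝓞 F) = v * z - (v * d * ω) * 2 := by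
    push_cast; rw [hz']; ring
  rw [e]
  exact P.sub_mem (P.mul_mem_left _ hz) (P.mul_mem_left _ h2P)

theorem sq_mod8_zero (B : ℤ) (h : B ^ 2 % 8 = 0) : B % 4 = 0 := by
  have h1 : B % 2 = 0 := by
    rcases Int.emod_two_eq_zero_or_one B with h1 | h1
    · exact h1
    · have := odd_sq8 B h1; omega
  obtain ⟨c, rfl⟩ : ∃ c, B = 2 * c := ⟨B / 2, by omega⟩
  have e : (2 * c) ^ 2 = 4 * c ^ 2 := by ring
  rw [e] at h
  rcases Int.emod_two_eq_zero_or_one c with h2 | h2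
  · omega
  · have := odd_sq8 c h2; omega

section EvenCase
variable {F K : Type*} [Field F] [NumberField F] [Field K] [NumberField K] [Algebra F K]

theorem even_case (D A2 B2 Dt δ s n N m e : ℤ) (hDpos : 0 < D) (hD4 : D % 4 = 1)
    (hhalf : A2 % 2 = B2 % 2)
    (hDt : 4 * Dt = A2 ^ 2 - B2 ^ 2 * D) (hsf : Squarefree Dt) (hDt4 : Dt % 4 = 1) (hδ : 0 < δ)
    (hs : D - 4 * δ = s ^ 2) (hNN : 4 * D * N = δ ^ 2 * Dt - n ^ 2)
    (hm : D * m = 2 * n + δ * A2) (he : 2 * e = A2 - B2 * s)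
    (hfund : IsFundamentalDiscriminant (δ * m))
    (hrF : Module.finrank ℚ F = 2) (hrK : Module.finrank F K = 2)
    (r : 𝓞 F) (hr : r ^ 2 = (Dt : 𝓞 F)) (hrn : ∀ c : ℚ, algebraMap ℚ F c ≠ (r : F))
    (ω : 𝓞 F) (hω : 2 * ω = 1 + r)
    (hT1 : ∀ (β : 𝓞 F) (k c : ℤ), k ≠ 0 → c ≠ 0 → (c : 𝓞 F) ^ 2 * β = k ^ 2 * (A2 + 2 * r) →
      ∃ t : 𝓞 K, t ^ 2 = algebraMap (𝓞 F) (𝓞 K) β ∧ ∀ c : F, algebraMap F K c ≠ (t : K))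
    (hT2 : ∀ (β : 𝓞 F) (k c : ℤ), k ≠ 0 → c ≠ 0 → (c : 𝓞 F) ^ 2 * β = k ^ 2 * (D * (A2 - 2 * r)) →
      ∃ t : 𝓞 K, t ^ 2 = algebraMap (𝓞 F) (𝓞 K) β ∧ ∀ c : F, algebraMap F K c ≠ (t : K))
    (P : Ideal (𝓞 F)) [P.IsMaximal] (hP0 : P ≠ ⊥)
    (h2P : (2 : 𝓞 F) ∈ P) (h2P2 : (2 : 𝓞 F) ∉ P ^ 2)
    (hram : ∀ (t : 𝓞 K) (β : 𝓞 F), t ^ 2 = algebraMap (𝓞 F) (𝓞 K) β → β + 1 ∈ P ^ 2 → False)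
    (N1 : ℤ) (hpN : N = 2 * N1)
    (z : 𝓞 F) (hz : z ∈ P) (hzr : 2 * z = n + δ * r) :
    SplitConcl K P ((e - m) % 8 = 1 ∨ (δ * m) % 8 = 1) ((e - m) % 8 = 5 ∨ (δ * m) % 8 = 5) := by
  have id1 := main_id1 D A2 B2 Dt δ n N m hDpos.ne' hDt hNN hm
  have id2 := main_id2 D A2 B2 δ N m s e id1 hs he
  have hmF : (D : 𝓞 F) * m = 2 * n + δ * A2 := by
    exact_mod_cast congrArg (Int.cast : ℤ → 𝓞 F) hm
  have hNF : 4 * (D : 𝓞 F) * N = δ ^ 2 * Dt - n ^ 2 := by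
    exact_mod_cast congrArg (Int.cast : ℤ → 𝓞 F) hNN
  have h20 : (2 : 𝓞 F) ≠ 0 := two_ne_zero
  have h40 : (4 : 𝓞 F) ≠ 0 := by
    rw [show (4 : 𝓞 F) = 2 * 2 by norm_num]; exact mul_ne_zero h20 h20
  have hzy : z * (n - z) = -(D * (2 * N1)) := by
    apply mul_left_cancel₀ h40
    have hpF : (N : 𝓞 F) = 2 * N1 := by exact_mod_cast congrArg (Int.cast : ℤ → 𝓞 F) hpN
    linear_combination (n - 2 * z - δ * r) * hzr - (δ : 𝓞 F) ^ 2 * hr + hNF - 4 * D * hpF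
  rcases Int.emod_two_eq_zero_or_one δ with hδ2 | hδ2
  · -- `δ` even: impossible
    exfalso
    obtain ⟨d, rfl⟩ : ∃ d, δ = 2 * d := ⟨δ / 2, by omega⟩
    have hn2 : n % 2 = 0 := by
      rcases Int.emod_two_eq_zero_or_one n with h | h
      · exact h
      · have := odd_sq8 n h
        have e2 : (2 * d) ^ 2 * Dt = 4 * (d ^ 2 * Dt) := by ring
        rw [e2, mul_assoc] at hNN
        omega
    obtain ⟨n', rfl⟩ : ∃ d, n = 2 * d := ⟨n / 2, by omega⟩
    have hNN' : 2 * (D * N1) = d ^ 2 * Dt - n' ^ 2 := by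
      subst hpN
      linarith
    have hm2 : m % 2 = 0 := by
      rcases Int.emod_two_eq_zero_or_one m with h | h
      · exact h
      · have h1 : (D * m) % 2 = 1 := by rw [Int.mul_emod, h, show D % 2 = 1 by omega]; norm_num
        have : 2 * (2 * n') + 2 * d * A2 = 2 * (2 * n' + d * A2) := by ring
        rw [hm, this] at h1
        omega
    obtain ⟨m', rfl⟩ : ∃ d, m = 2 * d := ⟨m / 2, by omega⟩
    have hm' : D * m' = 2 * n' + d * A2 := by linarith
    have hdm : (d * m') % 4 = 2 ∨ (d * m') % 4 = 3 := by
      rcases hfund with ⟨h, -⟩ | ⟨m0, h, -, h'⟩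
      · have : 2 * d * (2 * m') = 4 * (d * m') := by ring
        rw [this] at h; omega
      · have : 2 * d * (2 * m') = 4 * (d * m') := by ring
        rw [this] at h
        have : d * m' = m0 := by omega
        rw [this]; exact h'
    have hdodd : d % 2 = 1 := by
      rcases Int.emod_two_eq_zero_or_one d with h | h
      · exfalso
        obtain ⟨d', rfl⟩ : ∃ x, d = 2 * x := ⟨d / 2, by omega⟩
        have hm2 : m' % 2 = 0 := by
          rcases Int.emod_two_eq_zero_or_one m' with h | h
          · exact h
          · have h1 : (D * m') % 2 = 1 := by rw [Int.mul_emod, h, show D % 2 = 1 by omega]; norm_num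
            have : 2 * n' + 2 * d' * A2 = 2 * (n' + d' * A2) := by ring
            rw [hm', this] at h1
            omega
        obtain ⟨m'', rfl⟩ : ∃ x, m' = 2 * x := ⟨m' / 2, by omega⟩
        have : 2 * d' * (2 * m'') = 4 * (d' * m'') := by ring
        rw [this] at hdm; omega
      · exact h
    have hd8 := odd_sq8 d hdodd
    have hnodd : n' % 2 = 1 := by
      rcases Int.emod_two_eq_zero_or_one n' with h | h
      · exfalso
        obtain ⟨x, rfl⟩ : ∃ x, n' = 2 * x := ⟨n' / 2, by omega⟩
        have h1 : (d ^ 2 * Dt) % 2 = 1 := by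
          rw [Int.mul_emod, show Dt % 2 = 1 by omega, show d ^ 2 % 2 = 1 by omega]; norm_num
        have : (2 * x) ^ 2 = 2 * (2 * x ^ 2) := by ring
        rw [this] at hNN'
        omega
      · exact h
    rcases Int.emod_two_eq_zero_or_one m' with hme | hmo
    · obtain ⟨m'', rfl⟩ : ∃ x, m' = 2 * x := ⟨m' / 2, by omega⟩
      have hA : A2 % 2 = 0 := by
        rcases Int.emod_two_eq_zero_or_one A2 with h | h
        · exact h
        · have h1 : (d * A2) % 2 = 1 := by rw [Int.mul_emod, h, hdodd]; norm_num
          have : D * (2 * m'') = 2 * (D * m'') := by ring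
          rw [this] at hm'; omega
      obtain ⟨A, rfl⟩ : ∃ x, A2 = 2 * x := ⟨A2 / 2, by omega⟩
      obtain ⟨B, rfl⟩ : ∃ x, B2 = 2 * x := ⟨B2 / 2, by omega⟩
      have hm'' : D * m'' = n' + d * A := by linarith
      have hmo : m'' % 2 = 1 := by
        rcases Int.emod_two_eq_zero_or_one m'' with h | h
        · obtain ⟨x, rfl⟩ : ∃ x, m'' = 2 * x := ⟨m'' / 2, by omega⟩
          have : d * (2 * (2 * x)) = 4 * (d * x) := by ring
          rw [this] at hdm; omega
        · exact h
      have h1 : (D * m'') % 2 = 1 := by rw [Int.mul_emod, hmo, show D % 2 = 1 by omega]; norm_num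
      have hAe : A % 2 = 0 := by
        rcases Int.emod_two_eq_zero_or_one A with h | h
        · exact h
        · have h1 : (d * A) % 2 = 1 := by rw [Int.mul_emod, h, hdodd]; norm_num
          omega
      obtain ⟨a, rfl⟩ : ∃ x, A = 2 * x := ⟨A / 2, by omega⟩
      have hDt' : Dt = 4 * a ^ 2 - B ^ 2 * D := by linarith
      obtain ⟨D', rfl⟩ : ∃ x, D = 1 + 4 * x := ⟨D / 4, by omega⟩
      have e3 : B ^ 2 * (1 + 4 * D') = B ^ 2 + 4 * (B ^ 2 * D') := by ring
      rw [e3] at hDt'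
      rcases Int.emod_two_eq_zero_or_one B with h | h
      · obtain ⟨b, rfl⟩ : ∃ x, B = 2 * x := ⟨B / 2, by omega⟩
        have e4 : (2 * b) ^ 2 = 4 * b ^ 2 := by ring
        rw [e4] at hDt'
        omega
      · have := odd_sq8 B h
        omega
    · have h3 : (d * m') % 4 = 3 := by
        have : (d * m') % 2 = 1 := by rw [Int.mul_emod, hmo, hdodd]; norm_num
        omega
      obtain ⟨t, ht, -⟩ := hT2 (d ^ 2 * (D * (A2 - 2 * r))) d 1 (by omega) one_ne_zero (by push_cast; ring)
      apply hram t _ ht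
      obtain ⟨c, hc⟩ : ∃ c, n' - d = 2 * c := ⟨(n' - d) / 2, by omega⟩
      have hcF : (n' : 𝓞 F) - d = 2 * c := by exact_mod_cast congrArg (Int.cast : ℤ → 𝓞 F) hc
      have hmF' : (D : 𝓞 F) * m' = 2 * n' + d * A2 := by
        exact_mod_cast congrArg (Int.cast : ℤ → 𝓞 F) hm'
      have e1 : (d ^ 2 * (D * (A2 - 2 * r)) : 𝓞 F) + 1 =
          ((D ^ 2 * (d * m') + 1 : ℤ) : 𝓞 F) - 4 * (D * d * (c + d * ω)) := by
        push_cast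
        linear_combination -(D * d : 𝓞 F) * hmF' - 2 * (D * d : 𝓞 F) * hcF + 2 * (D * d * d : 𝓞 F) * hω
      rw [e1]
      refine Ideal.sub_mem _ (int_mem_sq P h2P _ ?_) (Ideal.mul_mem_right _ _ (four_mem P h2P))
      obtain ⟨i, hi⟩ : ∃ i, d * m' = 3 + 4 * i := ⟨d * m' / 4, by omega⟩
      obtain ⟨D', rfl⟩ : ∃ x, D = 1 + 4 * x := ⟨D / 4, by omega⟩
      have : (1 + 4 * D') ^ 2 * (d * m') + 1 = 4 * (1 + i + (2 * D' + 4 * D' ^ 2) * (d * m')) := by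
        linear_combination hi
      rw [this]; omega
  have hnodd := par_n D Dt δ n N hDt4 hNN hδ2
  have hres := res_even Dt δ n hsf hrF r hr hrn ω hω P h2P z hz hzr hδ2 hnodd
  have hnz : (n : 𝓞 F) - z ∉ P := by
    intro h
    have h1 := P.add_mem h hz
    rw [sub_add_cancel, int_mem_iff P 2 Nat.prime_two (by simpa using h2P)] at h1
    push_cast at h1
    omega
  rcases Int.emod_two_eq_zero_or_one m with hm2 | hm2
  swap
  · -- `m` odd
    have hdu : (δ * m) % 2 = 1 := by rw [Int.mul_emod, hm2, hδ2]; norm_num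
    obtain ⟨k, hk⟩ : ∃ k, δ * m = 1 + 4 * k := by
      rcases hfund with ⟨h, -⟩ | ⟨m0, h, -, h'⟩
      · exact ⟨δ * m / 4, by omega⟩
      · omega
    have hkF : (δ : 𝓞 F) * m = 1 + 4 * k := by exact_mod_cast congrArg (Int.cast : ℤ → 𝓞 F) hk
    obtain ⟨h1, h2⟩ := ie1 (δ * m) (e - m) (δ * B2 - s * m) N1 k (by rw [← id2, hpN]; ring) hk
    have hDk : (D ^ 2 * k) % 2 = k % 2 := by
      rw [Int.mul_emod]
      have := odd_sq8 D (by omega)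
      rw [show D ^ 2 % 2 = 1 by omega]; omega
    obtain ⟨t, ht, htn⟩ := hT2 (D ^ 2 + 4 * (D ^ 2 * k - D * δ * z)) δ 1 hδ.ne' one_ne_zero (by
      push_cast
      linear_combination -(D ^ 2 : 𝓞 F) * hkF + D * δ * hmF - 2 * D * δ * hzr)
    refine even_core P hP0 hrK h2P hres t htn _ _ ht D (D ^ 2 * k) (by simp) ?_ (by omega) _ _ ?_ ?_
    · have : (D : 𝓞 F) ^ 2 * k - D * δ * z - ((D ^ 2 * k : ℤ) : 𝓞 F) = -(D * δ) * z := by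
        push_cast; ring
      rw [this]; exact P.mul_mem_left _ hz
    · rw [hDk]; exact h1
    · rw [hDk]; exact h2
  -- `m` even
  obtain ⟨d, hd⟩ : ∃ x, δ = 1 + 2 * x := ⟨δ / 2, by omega⟩
  obtain ⟨m0, hm0, hm04⟩ : ∃ m0, δ * m = 4 * m0 ∧ (m0 % 4 = 2 ∨ m0 % 4 = 3) := by
    rcases hfund with ⟨h, -⟩ | ⟨m0, h, -, h'⟩
    · have : (δ * m) % 2 = 0 := by rw [Int.mul_emod, hm2]; simp
      omega
    · exact ⟨m0, h, h'⟩
  obtain ⟨k, rfl⟩ : ∃ k, m = 4 * k := by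
    obtain ⟨m1, rfl⟩ : ∃ x, m = 2 * x := ⟨m / 2, by omega⟩
    have : δ * (2 * m1) = 2 * m1 + 4 * (d * m1) := by rw [hd]; ring
    rw [this] at hm0
    exact ⟨m1 / 2, by omega⟩
  have hk0 : δ * k = m0 := by linarith
  have hA : A2 % 2 = 0 := by
    rcases Int.emod_two_eq_zero_or_one A2 with h | h
    · exact h
    · have h1 : (δ * A2) % 2 = 1 := by rw [Int.mul_emod, h, hδ2]; norm_num
      have : D * (4 * k) = 2 * (2 * (D * k)) := by ring
      rw [this] at hm; omega
  obtain ⟨A, rfl⟩ : ∃ x, A2 = 2 * x := ⟨A2 / 2, by omega⟩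
  obtain ⟨B, rfl⟩ : ∃ x, B2 = 2 * x := ⟨B2 / 2, by omega⟩
  have hDt' : Dt = A ^ 2 - B ^ 2 * D := by linarith
  have hn' : n = 2 * D * k - δ * A := by linarith
  have hAodd : A % 2 = 1 := by
    rcases Int.emod_two_eq_zero_or_one A with h | h
    · obtain ⟨a, rfl⟩ : ∃ x, A = 2 * x := ⟨A / 2, by omega⟩
      have : 2 * D * k - δ * (2 * a) = 2 * (D * k - δ * a) := by ring
      rw [this] at hn'; omega
    · exact h
  have hsodd : s % 2 = 1 := by
    rcases Int.emod_two_eq_zero_or_one s with h | h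
    · obtain ⟨a, rfl⟩ : ∃ x, s = 2 * x := ⟨s / 2, by omega⟩
      have : (2 * a) ^ 2 = 2 * (2 * a ^ 2) := by ring
      rw [this] at hs; omega
    · exact h
  have hs8 := odd_sq8 s hsodd
  have hD8 : D % 8 = 5 := by omega
  have hA8 := odd_sq8 A hAodd
  have hn8 := odd_sq8 n hnodd
  have hδ8 := odd_sq8 δ hδ2
  have hDt8 : Dt % 8 = 1 := by
    obtain ⟨x, hx⟩ : ∃ x, δ ^ 2 = 1 + 8 * x := ⟨δ ^ 2 / 8, by omega⟩
    have e1 : (1 + 8 * x) * Dt = Dt + 8 * (x * Dt) := by ring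
    have e2 : 4 * D * (2 * N1) = 8 * (D * N1) := by ring
    rw [hx, e1, hpN, e2] at hNN
    omega
  obtain ⟨b, rfl⟩ : ∃ b, B = 4 * b := by
    have : B % 4 = 0 := by
      apply sq_mod8_zero
      obtain ⟨x, hx⟩ : ∃ x, D = 5 + 8 * x := ⟨D / 8, by omega⟩
      have e1 : B ^ 2 * D = 5 * B ^ 2 + 8 * (B ^ 2 * x) := by rw [hx]; ring
      rw [e1] at hDt'
      omega
    exact ⟨B / 4, by omega⟩
  have hdx : e - 4 * k = A - 4 * (b * s) - 4 * k := by linarith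
  have hNu : N = δ * k * (e - 4 * k) - (2 * δ * b - s * k) ^ 2 := by linarith
  have hdu8 : (δ * (4 * k)) % 8 ≠ 1 ∧ (δ * (4 * k)) % 8 ≠ 5 := by omega
  have hmF' : (2 : 𝓞 F) * D * k = n + δ * A := by
    have : 2 * D * k = n + δ * A := by linarith
    exact_mod_cast congrArg (Int.cast : ℤ → 𝓞 F) this
  obtain ⟨D', hD'⟩ : ∃ x, D = 1 + 4 * x := ⟨D / 4, by omega⟩
  rcases Int.emod_two_eq_zero_or_one k with hk2 | hk2
  swap
  · -- `k` odd
    have h3 : (δ * k) % 4 = 3 := by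
      have : (δ * k) % 2 = 1 := by rw [Int.mul_emod, hk2, hδ2]; norm_num
      omega
    obtain ⟨i, hi⟩ : ∃ i, δ * k = 3 + 4 * i := ⟨δ * k / 4, by omega⟩
    obtain ⟨t, ht, htn⟩ := hT2 ((D ^ 2 * (δ * k) : ℤ) + (-(D * δ) : ℤ) * z) δ 2 hδ.ne' two_ne_zero (by
      push_cast
      linear_combination 2 * (D * δ : 𝓞 F) * hmF' - 2 * D * δ * hzr)
    rcases Int.emod_two_eq_zero_or_one N1 with hN | hN
    · exfalso
      have hzz : z ∈ P ^ 2 := by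
        apply mem_sq_of_mul P _ _ hnz
        rw [mul_comm, hzy]
        have : -((D : 𝓞 F) * (2 * N1)) = ((-(D * (2 * N1)) : ℤ) : 𝓞 F) := by push_cast; ring
        rw [this]
        apply int_mem_sq P h2P
        obtain ⟨N2, rfl⟩ : ∃ x, N1 = 2 * x := ⟨N1 / 2, by omega⟩
        have : -(D * (2 * (2 * N2))) = 4 * (-(D * N2)) := by ring
        rw [this]; omega
      apply hram t _ ht
      have e1 : (((D ^ 2 * (δ * k) : ℤ) : 𝓞 F) + (-(D * δ) : ℤ) * z) + 1 =
        ((D ^ 2 * (δ * k) + 1 : ℤ) : 𝓞 F) + (-(D * δ) : ℤ) * z := by push_cast; ring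
      rw [e1]
      refine Ideal.add_mem _ (int_mem_sq P h2P _ ?_) (Ideal.mul_mem_left _ _ hzz)
      have : D ^ 2 * (δ * k) + 1 = 4 * (1 + i + (2 * D' + 4 * D' ^ 2) * (δ * k)) := by
        rw [hD']; linear_combination hi
      rw [this]; omega
    · obtain ⟨l, hl⟩ : ∃ l, N1 = 1 + 2 * l := ⟨N1 / 2, by omega⟩
      have hDsq := odd_sq8 D (by omega)
      have hc0 : (D ^ 2 * (δ * k)) % 4 = 3 := by
        rw [Int.mul_emod, h3, show D ^ 2 % 4 = 1 by omega]; norm_num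
      obtain ⟨j, hj⟩ : ∃ j, D ^ 2 * (δ * k) - 1 = 2 * j := ⟨(D ^ 2 * (δ * k) - 1) / 2, by omega⟩
      have hjodd : j % 2 = 1 := by omega
      obtain ⟨q, hq⟩ : ∃ q, 2 * q = j * n + D * δ * D * N1 := by
        refine ⟨(j * n + D * δ * D * N1) / 2, ?_⟩
        have p1 : (j * n) % 2 = 1 := by rw [Int.mul_emod, hjodd, hnodd]; norm_num
        have p2 : (D * δ * D * N1) % 2 = 1 := by
          rw [Int.mul_emod, Int.mul_emod (D * δ), Int.mul_emod D δ, hN, hδ2, show D % 2 = 1 by omega]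
          norm_num
        omega
      have hu : (2 * δ * b - s * k) % 2 = 1 := by
        have p1 : (s * k) % 2 = 1 := by rw [Int.mul_emod, hsodd, hk2]; norm_num
        rw [mul_assoc]; omega
      obtain ⟨f1, f2⟩ := ie2a D δ k i n A (e - 4 * k) N1 l (2 * δ * b - s * k) b s j q hD8 hδ2 hk2 hi hn'
        hdx (by rw [← hNu, hpN]) hu hl hj hq
      refine even_template P hP0 hrK h2P hres t htn D n N1 _ _ j q z hz hzy hnodd ht hj
        (by linear_combination hq) _ _ ?_ ?_
      · rw [← f1]; simp [hdu8.1]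
      · rw [← f2]; simp [hdu8.2]
  · -- `k` even
    obtain ⟨k', rfl⟩ : ∃ x, k = 2 * x := ⟨k / 2, by omega⟩
    have hk2' : k' % 2 = 1 := by
      rcases Int.emod_two_eq_zero_or_one k' with h | h
      · obtain ⟨x, rfl⟩ : ∃ x, k' = 2 * x := ⟨k' / 2, by omega⟩
        have : δ * (2 * (2 * x)) = 4 * (δ * x) := by ring
        omega
      · exact h
    have hNu' : N1 = δ * k' * (e - 4 * (2 * k')) - 2 * (δ * b - s * k') ^ 2 := by
      apply mul_left_cancel₀ (two_ne_zero : (2 : ℤ) ≠ 0)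
      rw [← hpN, hNu]; ring
    have hdkodd : (δ * k') % 2 = 1 := by rw [Int.mul_emod, hk2', hδ2]; norm_num
    have hN1odd : N1 % 2 = 1 := by
      have p1 : (δ * k' * (e - 4 * (2 * k'))) % 2 = 1 := by
        rw [Int.mul_emod, hdkodd, hdx, show (A - 4 * (b * s) - 4 * (2 * k')) % 2 = 1 by omega]; norm_num
      omega
    have hDN1 : (D * N1) % 2 = 1 := by
      rw [Int.mul_emod, hN1odd, show D % 2 = 1 by omega]; norm_num
    have hDdk : (D * (δ * k')) % 2 = 1 := by
      rw [Int.mul_emod, hdkodd, show D % 2 = 1 by omega]; norm_num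
    obtain ⟨x, hx⟩ : ∃ x, δ ^ 2 = 1 + 8 * x := ⟨δ ^ 2 / 8, by omega⟩
    obtain ⟨t, ht, htn⟩ := hT1 ((δ ^ 2 * A - δ * D * (2 * k') : ℤ) + (δ : ℤ) * z) δ 2 hδ.ne' two_ne_zero (by
      push_cast at hmF' ⊢
      linear_combination -2 * (δ : 𝓞 F) * hmF' + 2 * δ * hzr)
    have hAA : A % 4 = 1 ∨ A % 4 = 3 := by omega
    rcases hAA with hA4 | hA4
    swap
    · exfalso
      have hzz : z - 2 ∈ P ^ 2 := by
        apply mem_sq_of_mul P _ _ hnz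
        have : ((n : 𝓞 F) - z) * (z - 2) = 2 * (z - ((D * N1 + n : ℤ) : 𝓞 F)) := by
          push_cast
          linear_combination hzy
        rw [this, pow_two]
        apply Ideal.mul_mem_mul h2P
        refine P.sub_mem hz ?_
        rw [int_mem_iff P 2 Nat.prime_two (by simpa using h2P)]
        push_cast
        omega
      apply hram t _ ht
      have e1 : (((δ ^ 2 * A - δ * D * (2 * k') : ℤ) : 𝓞 F) + (δ : ℤ) * z) + 1 =
        ((δ ^ 2 * A - δ * D * (2 * k') + 2 * δ + 1 : ℤ) : 𝓞 F) + (δ : ℤ) * (z - 2) := by push_cast; ring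
      rw [e1]
      refine Ideal.add_mem _ (int_mem_sq P h2P _ ?_) (Ideal.mul_mem_left _ _ hzz)
      have : δ ^ 2 * A - δ * D * (2 * k') + 2 * δ + 1 = A + 8 * (x * A) - 2 * (D * (δ * k')) + 2 * δ + 1 := by
        rw [hx]; ring
      rw [this]; omega
    · obtain ⟨A', hA'⟩ : ∃ x, A = 1 + 4 * x := ⟨A / 4, by omega⟩
      obtain ⟨j, hj, hjodd⟩ : ∃ j, δ ^ 2 * A - δ * D * (2 * k') - 1 = 2 * j ∧ j % 2 = 1 := by
        have : δ ^ 2 * A - δ * D * (2 * k') - 1 = 2 * (2 * A' + 4 * x * A - D * (δ * k')) := by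
          rw [hx, hA']; ring
        refine ⟨_, this, ?_⟩
        rw [mul_assoc]; omega
      obtain ⟨q, hq⟩ : ∃ q, 2 * q = j * n - δ * D * N1 := by
        refine ⟨(j * n - δ * D * N1) / 2, ?_⟩
        have p1 : (j * n) % 2 = 1 := by rw [Int.mul_emod, hjodd, hnodd]; norm_num
        have p2 : (δ * D * N1) % 2 = 1 := by
          rw [mul_assoc, Int.mul_emod, hDN1, hδ2]; norm_num
        omega
      obtain ⟨f1, f2⟩ := ie2b D δ k' n A A' (e - 4 * (2 * k')) N1 (δ * b - s * k') b s j q hD8 hδ2 hk2' hsodd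
        (by linarith) hA' (by linarith) rfl hNu' hj hq
      refine even_template P hP0 hrK h2P hres t htn D n N1 _ _ j q z hz hzy hnodd ht hj
        (by linear_combination hq) _ _ ?_ ?_
      · rw [← f1]; simp [hdu8.1]
      · rw [← f2]; simp [hdu8.2]
end EvenCase

/-- Under the standing assumptions (`D` prime `≡ 1 mod 4`, `~D` squarefree
`≡ 1 mod 4`, `N(𝔇_{~K/~F}) = D`, `d_u(n)` fundamental), let `p ∣ N` and let `p̂` be the
unique prime of `𝓞 ~F` above `p` dividing `(n + δ√~D)/(2D) · 𝔇_{~K/~F}`.  Then `p̂`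
splits in `~K` iff `p` splits in at least one of `𝒪_{d_x}`, `𝒪_{d_u}`, and `p̂` is inert
in `~K` iff `p` is inert in at least one of `𝒪_{d_x}`, `𝒪_{d_u}`.
(Here `d_u = δ m`, `d_x = e - m` with `m = (2n + δ A2)/D` and `e = (A2 - B2 s)/2`.) -/
theorem stmt_14 (D : ℤ) (hDp : Prime D) (hDpos : 0 < D) (hD4 : D % 4 = 1)
    (A2 B2 : ℤ) (hhalf : A2 % 2 = B2 % 2)
    (Dt : ℤ) (hDt : 4 * Dt = A2 ^ 2 - B2 ^ 2 * D)
    (hDtsf : Squarefree Dt) (hDtpos : 0 < Dt) (hDt4 : Dt % 4 = 1)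
    (Ft Kt : Type*) [Field Ft] [NumberField Ft] [Field Kt] [NumberField Kt]
    [Algebra Ft Kt] [Module.Free (𝓞 Ft) (𝓞 Kt)]
    (hrF : Module.finrank ℚ Ft = 2) (hrK : Module.finrank Ft Kt = 2)
    (r : Ft) (hr : r ^ 2 = (Dt : Ft))
    (w : Kt) (hw : w ^ 2 = algebraMap Ft Kt ((A2 : Ft) + 2 * r))
    (hnorm : (Ideal.absNorm
      (Ideal.relNorm (𝓞 Ft) (differentIdeal (𝓞 Ft) (𝓞 Kt))) : ℤ) = D)
    (cK : ℤ) (hcKodd : Odd cK) (hcKA : D ∣ 2 * cK - A2)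
    (δ : ℤ) (hδ : 0 < δ) (s : ℤ) (hs : D - 4 * δ = s ^ 2)
    (n : ℤ) (hn : (2 * D) ∣ (n + cK * δ))
    (NN : ℕ) (hNN : 4 * D * (NN : ℤ) = δ ^ 2 * Dt - n ^ 2) (hNNpos : 0 < NN)
    (m : ℤ) (hm : D * m = 2 * n + δ * A2)
    (e : ℤ) (he : 2 * e = A2 - B2 * s)
    (hfund : IsFundamentalDiscriminant (δ * m))
    (J : Ideal (𝓞 Ft))
    (hJ : (J : FractionalIdeal (𝓞 Ft)⁰ Ft) =
      FractionalIdeal.spanSingleton (𝓞 Ft)⁰ (((n : Ft) + (δ : Ft) * r) / (2 * (D : Ft))) *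
        (Ideal.relNorm (𝓞 Ft) (differentIdeal (𝓞 Ft) (𝓞 Kt)) :
          FractionalIdeal (𝓞 Ft)⁰ Ft))
    (p : ℕ) (hp : p.Prime) (hpN : p ∣ NN)
    (P : HeightOneSpectrum (𝓞 Ft))
    (hPp : (p : 𝓞 Ft) ∈ P.asIdeal) (hPJ : P.asIdeal ∣ J) :
    ((∃ Q1 Q2 : Ideal (𝓞 Kt), Q1.IsPrime ∧ Q2.IsPrime ∧ Q1 ≠ Q2 ∧
        Ideal.map (algebraMap (𝓞 Ft) (𝓞 Kt)) P.asIdeal = Q1 * Q2) ↔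
      (SplitsInOrder (e - m) p hp ∨ SplitsInOrder (δ * m) p hp)) ∧
    ((Ideal.map (algebraMap (𝓞 Ft) (𝓞 Kt)) P.asIdeal).IsPrime ↔
      (InertInOrder (e - m) p hp ∨ InertInOrder (δ * m) p hp)) := by
  have hD0 : D ≠ 0 := hDpos.ne'
  have hDt1 := Dt_ne_one D A2 B2 Dt cK δ s n NN hDp hDpos hD4 hDt hcKA hδ hs hn hNN
    (by exact_mod_cast hNNpos)
  have hns := not_sq_of_sf Dt hDtsf hDt1
  have hrn := r_not_rat Dt hns r hr
  have hB2 : B2 ≠ 0 := by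
    rintro rfl
    apply hns
    have hA : A2 % 2 = 0 := by simpa using hhalf
    obtain ⟨a, rfl⟩ : ∃ a, A2 = 2 * a := ⟨A2 / 2, by omega⟩
    exact ⟨a, by linarith⟩
  have hwn := w_not_F hrF D A2 B2 Dt hDp hDt hB2 r hr hrn w hw
  have hri : IsIntegral (𝓞 Ft) r := by
    apply integral_of_quad r 0 (-(Dt : 𝓞 Ft))
    rw [map_neg, map_zero, map_intCast]
    linear_combination hr
  obtain ⟨rO, hrO⟩ := IsIntegrallyClosed.isIntegral_iff.mp hri
  subst hrO
  have hrO2 : rO ^ 2 = (Dt : 𝓞 Ft) := by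
    apply RingOfIntegers.coe_injective
    rw [map_pow, hr, map_intCast]
  obtain ⟨ω, hω⟩ := exists_omega Dt hDt4 rO hrO2
  have hmax : P.asIdeal.IsMaximal := P.isMaximal
  have hP0 : P.asIdeal ≠ ⊥ := P.ne_bot
  have hDI : (D : 𝓞 Ft) ∈ Ideal.relNorm (𝓞 Ft) (differentIdeal (𝓞 Ft) (𝓞 Kt)) := by
    have h1 := Ideal.absNorm_mem (Ideal.relNorm (𝓞 Ft) (differentIdeal (𝓞 Ft) (𝓞 Kt)))
    have h2 := congrArg (Int.cast : ℤ → 𝓞 Ft) hnorm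
    rw [Int.cast_natCast] at h2
    rwa [h2] at h1
  obtain ⟨z, hz, hzr⟩ := z_exists D n δ hD0 rO _ J P.asIdeal hDI hPJ hJ
  have hw0 : w ≠ 0 := fun h => hwn 0 (by rw [map_zero, h])
  have hw'sq : ((B2 : Kt) * D / w) ^ 2 =
      algebraMap Ft Kt ((D : Ft) * (A2 - 2 * algebraMap (𝓞 Ft) Ft rO)) := by
    have hDtF : (4 : Ft) * Dt = A2 ^ 2 - B2 ^ 2 * D := by
      exact_mod_cast congrArg (Int.cast : ℤ → Ft) hDt
    rw [div_pow, div_eq_iff (pow_ne_zero 2 hw0), hw, ← map_mul]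
    have : ((B2 : Kt) * D) ^ 2 = algebraMap Ft Kt (((B2 : Ft) * D) ^ 2) := by simp
    rw [this]
    congr 1
    linear_combination (D : Ft) * hDtF + 4 * D * hr
  have hw'n : ∀ c : Ft, algebraMap Ft Kt c ≠ (B2 : Kt) * D / w := by
    intro c hc
    have hBD : (B2 : Kt) * D ≠ 0 := by
      apply mul_ne_zero <;> exact_mod_cast ‹_›
    have hc0 : algebraMap Ft Kt c ≠ 0 := by rw [hc]; exact div_ne_zero hBD hw0
    apply hwn ((B2 : Ft) * D / c)
    rw [map_div₀, map_mul, map_intCast, map_intCast, div_eq_iff hc0, hc]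
    field_simp
  have hT1 : ∀ (β : 𝓞 Ft) (k c : ℤ), k ≠ 0 → c ≠ 0 →
      (c : 𝓞 Ft) ^ 2 * β = k ^ 2 * (A2 + 2 * rO) →
      ∃ t : 𝓞 Kt, t ^ 2 = algebraMap (𝓞 Ft) (𝓞 Kt) β ∧
        ∀ c : Ft, algebraMap Ft Kt c ≠ (t : Kt) := by
    intro β k c hk hc h
    have hcF : (c : Ft) ≠ 0 := by exact_mod_cast hc
    have hkF : (k : Ft) ≠ 0 := by exact_mod_cast hk
    refine t_helper w hwn _ hw β (k / c) (div_ne_zero hkF hcF) ?_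
    have h' := congrArg (algebraMap (𝓞 Ft) Ft) h
    simp only [map_mul, map_pow, map_add, map_intCast, map_ofNat] at h'
    rw [div_pow, div_mul_eq_mul_div, eq_div_iff (pow_ne_zero 2 hcF)]
    linear_combination h'
  have hT2 : ∀ (β : 𝓞 Ft) (k c : ℤ), k ≠ 0 → c ≠ 0 →
      (c : 𝓞 Ft) ^ 2 * β = k ^ 2 * (D * (A2 - 2 * rO)) →
      ∃ t : 𝓞 Kt, t ^ 2 = algebraMap (𝓞 Ft) (𝓞 Kt) β ∧
        ∀ c : Ft, algebraMap Ft Kt c ≠ (t : Kt) := by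
    intro β k c hk hc h
    have hcF : (c : Ft) ≠ 0 := by exact_mod_cast hc
    have hkF : (k : Ft) ≠ 0 := by exact_mod_cast hk
    refine t_helper _ hw'n _ hw'sq β (k / c) (div_ne_zero hkF hcF) ?_
    have h' := congrArg (algebraMap (𝓞 Ft) Ft) h
    simp only [map_mul, map_pow, map_sub, map_intCast, map_ofNat] at h'
    rw [div_pow, div_mul_eq_mul_div, eq_div_iff (pow_ne_zero 2 hcF)]
    linear_combination h'
  by_cases hp2 : p = 2
  · subst hp2
    have h2P : (2 : 𝓞 Ft) ∈ P.asIdeal := by simpa using hPp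
    have h2P2 := two_not_mem_sq hrF Dt hDtsf hDt4 rO hrO2 hrn P.asIdeal
    have hdiff : ¬ Ideal.relNorm (𝓞 Ft) (differentIdeal (𝓞 Ft) (𝓞 Kt)) ≤ P.asIdeal := by
      intro hle
      have h1 := hle hDI
      rw [int_mem_iff P.asIdeal 2 Nat.prime_two hPp] at h1
      push_cast at h1
      omega
    obtain ⟨N1, hN1⟩ := hpN
    have := even_case D A2 B2 Dt δ s n NN m e hDpos hD4 hhalf hDt hDtsf hDt4 hδ hs hNN hm he hfund
      hrF hrK rO hrO2 hrn ω hω hT1 hT2 P.asIdeal hP0 h2P h2P2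
      (ram_aux P.asIdeal hP0 h2P h2P2 hdiff) N1 (by exact_mod_cast hN1) z hz hzr
    simpa only [SplitConcl, SplitsInOrder, InertInOrder, if_true] using this
  · haveI : Fact p.Prime := ⟨hp⟩
    have := odd_case D A2 B2 Dt δ s n NN m e hDp hDpos hDt hDtsf hδ hs hNN hm he hfund
      hrF hrK rO hrO2 hrn ω hω hT1 hT2 P.asIdeal hP0 p hp2 hPp (by exact_mod_cast hpN) z hz hzr
    simpa only [SplitConcl, SplitsInOrder, InertInOrder, if_neg hp2] using this
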